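/- arXiv:1806.09437 — 2 statements merged into one kernel-verified Lean document; each statement's English description precedes it below -/
import Mathlib

section
/- Let n ≥ 3, m ≥ 2, and for each ε ∈ (0, 4/(n−2)) let u_ε be a radial Neumann solution with exactly m−1 interior zeros. Then there exist C₁ > 0 and ε₀ ∈ (0, 4/(n−2)), independent of ε, such that for all ε ∈ (0, ε₀): ∫_0^1 |u_ε(r)|^{2n/(n−2)−ε} r^{n−1} dr + ∫_0^1 |u_ε'(r)|² r^{n−1} dr < C₁ (equivalently, the L^{2n/(n−2)−ε}(B) norm of u_ε and the L²(B) norm of its gradient are bounded uniformly in ε). -/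
open Real Set Filter Topology MeasureTheory

noncomputable section

/-- `κ_n = ((n-2)/4) · Γ(n/2)² / Γ(n)`. -/
def kappa (n : ℕ) : ℝ :=
  (((n : ℝ) - 2) / 4) * Real.Gamma ((n : ℝ) / 2) ^ 2 / Real.Gamma (n : ℝ)

/-- `p_ε = (n+2)/(n-2) - ε`. -/
def pEps (n : ℕ) (ε : ℝ) : ℝ := ((n : ℝ) + 2) / ((n : ℝ) - 2) - ε

/-- `u ∈ C²([0,1])` is a radial solution of `-Δu = |u|^{p-1} u` on the unit ball of `ℝⁿ`,
written in the radial variable: `(r^{n-1} u')' = -|u|^{p-1} u · r^{n-1}` on `(0,1]`,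
with `u'(0) = 0`. -/
def IsRadialSolution (n : ℕ) (p : ℝ) (u : ℝ → ℝ) : Prop :=
  ContDiffOn ℝ 2 u (Set.Icc 0 1) ∧ deriv u 0 = 0 ∧
    ∀ r ∈ Set.Ioc (0 : ℝ) 1,
      deriv (fun s => s ^ (n - 1) * deriv u s) r = -(|u r| ^ (p - 1) * u r * r ^ (n - 1))

/-- Radial Dirichlet solution with exactly `m-1` interior zeros, together with the
decreasing enumeration of its zeros `ρ 1 = 1 > ρ 2 > … > ρ m > 0` in `(0,1]` and of its
critical points `1 > δ 1 > … > δ m = 0` in `[0,1]`, interlaced as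
`0 = δ m < ρ m < δ (m-1) < … < δ 1 < ρ 1 = 1`. -/
def DirichletData (n : ℕ) (p : ℝ) (m : ℕ) (u : ℝ → ℝ) (ρ δ : ℕ → ℝ) : Prop :=
  IsRadialSolution n p u ∧ u 1 = 0 ∧ ρ 1 = 1 ∧ δ m = 0 ∧
    (∀ k, 1 ≤ k → k ≤ m → δ k < ρ k) ∧
    (∀ k, 1 ≤ k → k + 1 ≤ m → ρ (k + 1) < δ k) ∧
    {r : ℝ | r ∈ Set.Ioc (0 : ℝ) 1 ∧ u r = 0} = ρ '' Set.Icc 1 m ∧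
    {r : ℝ | r ∈ Set.Icc (0 : ℝ) 1 ∧ deriv u r = 0} = δ '' Set.Icc 1 m

/-- Radial Neumann solution with exactly `m-1` interior zeros, together with the
decreasing enumeration of its zeros `1 > ρ 1 > … > ρ (m-1) > 0` in `(0,1)` and of its
critical points `δ 1 = 1 > δ 2 > … > δ m = 0` in `[0,1]`, interlaced as
`0 = δ m < ρ (m-1) < δ (m-1) < … < ρ 1 < δ 1 = 1`. -/
def NeumannData (n : ℕ) (p : ℝ) (m : ℕ) (u : ℝ → ℝ) (ρ δ : ℕ → ℝ) : Prop :=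
  IsRadialSolution n p u ∧ deriv u 1 = 0 ∧ δ 1 = 1 ∧ δ m = 0 ∧
    (∀ k, 1 ≤ k → k ≤ m - 1 → ρ k < δ k) ∧
    (∀ k, 1 ≤ k → k ≤ m - 1 → δ (k + 1) < ρ k) ∧
    {r : ℝ | r ∈ Set.Ioo (0 : ℝ) 1 ∧ u r = 0} = ρ '' Set.Icc 1 (m - 1) ∧
    {r : ℝ | r ∈ Set.Icc (0 : ℝ) 1 ∧ deriv u r = 0} = δ '' Set.Icc 1 m

/-- A nontrivial radial Dirichlet solution with exactly `m-1` interior zeros. -/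
def DirichletSol (n : ℕ) (p : ℝ) (m : ℕ) (u : ℝ → ℝ) : Prop :=
  IsRadialSolution n p u ∧ u 1 = 0 ∧ (∃ r ∈ Set.Icc (0 : ℝ) 1, u r ≠ 0) ∧
    ∃ Z : Finset ℝ, (Z : Set ℝ) = {r | r ∈ Set.Ioo (0 : ℝ) 1 ∧ u r = 0} ∧ Z.card = m - 1

/-- A nontrivial radial Neumann solution with exactly `m-1` interior zeros. -/
def NeumannSol (n : ℕ) (p : ℝ) (m : ℕ) (u : ℝ → ℝ) : Prop :=
  IsRadialSolution n p u ∧ deriv u 1 = 0 ∧ (∃ r ∈ Set.Icc (0 : ℝ) 1, u r ≠ 0) ∧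
    ∃ Z : Finset ℝ, (Z : Set ℝ) = {r | r ∈ Set.Ioo (0 : ℝ) 1 ∧ u r = 0} ∧ Z.card = m - 1


structure EF (σ b p : ℝ) (w w1 E : ℝ → ℝ) : Prop where
  hσ : 0 < σ
  hp : 1 < p
  hw : ∀ t < 0, HasDerivAt w (w1 t) t
  hw1 : ∀ t < 0, HasDerivAt w1 (σ * w1 t + b * w t - |w t| ^ (p - 1) * w t) t
  hE : ∀ t < 0, HasDerivAt E (exp (-σ * t) * |w t| ^ (p + 1)) t
  limw : Tendsto w atBot (𝓝 0)
  limw1 : Tendsto w1 atBot (𝓝 0)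
  limE : Tendsto E atBot (𝓝 0)

structure EFC (σ b p c q ω Ω B P : ℝ) : Prop where
  hc : 0 < c
  hq : 0 < q
  hω : 0 < ω
  hΩ : 1 ≤ Ω
  hb : 0 < b
  hB : b ≤ B
  hP : p ≤ P
  hσ1 : σ ≤ 1
  hσc : σ ≤ c
  hσq : σ ≤ q
  h1 : 2 * ω ^ (p - 1) / (p + 1) + c ^ 2 ≤ b
  h2 : b + q ^ 2 ≤ ω ^ (p - 1)
  h3 : b + 1 ≤ 2 * Ω ^ (p - 1) / (p + 1)

def Ham (b p : ℝ) (w w1 : ℝ → ℝ) (t : ℝ) : ℝ :=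
  w1 t ^ 2 / 2 - b * w t ^ 2 / 2 + |w t| ^ (p + 1) / (p + 1)

lemma abs_rpow_split (x p : ℝ) (hp : 1 < p) : |x| ^ (p + 1) = |x| ^ (p - 1) * x ^ 2 := by
  rcases eq_or_ne x 0 with rfl | hx
  · simp [Real.zero_rpow (by linarith : p + 1 ≠ 0)]
  · have : 0 < |x| := abs_pos.mpr hx
    rw [← sq_abs x, ← Real.rpow_natCast, ← Real.rpow_add this]
    congr 1; push_cast; ring

lemma mono_of_deriv {f f' : ℝ → ℝ} {s t : ℝ} (hst : s ≤ t)
    (hc : ContinuousOn f (Icc s t))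
    (h : ∀ x ∈ Ioo s t, HasDerivAt f (f' x) x) (h0 : ∀ x ∈ Ioo s t, 0 ≤ f' x) : f s ≤ f t := by
  have := monotoneOn_of_deriv_nonneg (convex_Icc s t) hc
    (fun x hx => by
      rw [interior_Icc] at hx
      exact (h x hx).differentiableAt.differentiableWithinAt)
    (fun x hx => by
      rw [interior_Icc] at hx
      rw [(h x hx).deriv]; exact h0 x hx)
  exact this (left_mem_Icc.mpr hst) (right_mem_Icc.mpr hst) hst

/-- constant sign for nonvanishing continuous functions -/
lemma sign_const {f : ℝ → ℝ} {s t : ℝ} (hc : ContinuousOn f (Ioo s t))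
    (h : ∀ x ∈ Ioo s t, f x ≠ 0) : (∀ x ∈ Ioo s t, 0 < f x) ∨ (∀ x ∈ Ioo s t, f x < 0) := by
  by_contra! hcon
  obtain ⟨⟨x, hx, hx0⟩, ⟨y, hy, hy0⟩⟩ := hcon
  have := isPreconnected_Ioo.intermediate_value hx hy hc
  obtain ⟨z, hz, hz0⟩ := this ⟨hx0, hy0⟩
  exact h z hz hz0

section
variable {σ b p : ℝ} {w w1 E : ℝ → ℝ}

lemma EF.cw (h : EF σ b p w w1 E) {t : ℝ} (ht : t < 0) : ContinuousAt w t := (h.hw t ht).continuousAt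
lemma EF.cw1 (h : EF σ b p w w1 E) {t : ℝ} (ht : t < 0) : ContinuousAt w1 t :=
  (h.hw1 t ht).continuousAt

lemma EF.hH (h : EF σ b p w w1 E) {t : ℝ} (ht : t < 0) :
    HasDerivAt (Ham b p w w1) (σ * w1 t ^ 2) t := by
  have hp := h.hp
  have h1 := (hasDerivAt_abs_rpow (w t) (p := p + 1) (by linarith)).comp t (h.hw t ht)
  have h2 := (((h.hw1 t ht).pow 2).div_const 2).sub ((((h.hw t ht).pow 2).const_mul b).div_const 2)
  have h3 := h2.add (h1.div_const (p + 1))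
  refine h3.congr_deriv ?_
  have : p + 1 ≠ 0 := by linarith
  have e : p + 1 - 2 = p - 1 := by ring
  rw [e]
  field_simp
  ring

lemma EF.H_mono (h : EF σ b p w w1 E) {s t : ℝ} (hst : s ≤ t) (ht : t < 0) :
    Ham b p w w1 s ≤ Ham b p w w1 t := by
  refine mono_of_deriv hst (fun x hx => (h.hH (by linarith [hx.2])).continuousAt.continuousWithinAt)
    (fun x hx => h.hH (by linarith [hx.2])) (fun x hx => ?_)
  have := h.hσ
  positivity

lemma EF.limH (h : EF σ b p w w1 E) : Tendsto (Ham b p w w1) atBot (𝓝 0) := by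
  have hp := h.hp
  have h1 : Tendsto (fun t => |w t| ^ (p + 1)) atBot (𝓝 0) := by
    have := (h.limw.abs).rpow_const (p := p + 1) (Or.inr (by linarith))
    simpa [Real.zero_rpow (by linarith : p + 1 ≠ 0)] using this
  have := (((h.limw1.pow 2).div_const 2).sub (((h.limw.pow 2).const_mul b).div_const 2)).add
    (h1.div_const (p + 1))
  have e : Ham b p w w1 = fun x => w1 x ^ 2 / 2 - b * w x ^ 2 / 2 + |w x| ^ (p + 1) / (p + 1) := rfl
  rw [e]
  simpa using this

lemma EF.H_nonneg (h : EF σ b p w w1 E) {t : ℝ} (ht : t < 0) : 0 ≤ Ham b p w w1 t := by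
  refine le_of_tendsto h.limH ?_
  filter_upwards [eventually_le_atBot t] with s hs using h.H_mono hs ht

lemma EF.E_mono (h : EF σ b p w w1 E) {s t : ℝ} (hst : s ≤ t) (ht : t < 0) : E s ≤ E t := by
  refine mono_of_deriv hst (fun x hx => (h.hE x (by linarith [hx.2])).continuousAt.continuousWithinAt)
    (fun x hx => h.hE x (by linarith [hx.2])) (fun x hx => ?_)
  positivity

/-- strict positivity of the Hamiltonian when zeros are finite -/
lemma EF.H_pos (h : EF σ b p w w1 E) (Z : Finset ℝ) (hZ : ∀ t < 0, w t = 0 → t ∈ Z)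
    {t : ℝ} (ht : t < 0) : 0 < Ham b p w w1 t := by
  rcases (h.H_nonneg ht).lt_or_eq with h0 | h0
  · exact h0
  exfalso
  have hH0 : ∀ s ≤ t, Ham b p w w1 s = 0 := fun s hs =>
    le_antisymm (h0 ▸ h.H_mono hs ht) (h.H_nonneg (by linarith))
  have hw10 : ∀ s < t, w1 s = 0 := by
    intro s hs
    have hd : HasDerivAt (Ham b p w w1) 0 s := by
      refine (hasDerivAt_const s (0 : ℝ)).congr_of_eventuallyEq ?_
      filter_upwards [Iio_mem_nhds hs] with x hx using hH0 x (le_of_lt hx)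
    have := (h.hH (by linarith : s < 0)).unique hd
    have h2 := h.hσ
    have : w1 s ^ 2 = 0 := by
      rcases mul_eq_zero.mp this with h3 | h3
      · linarith
      · exact h3
    simpa using this
  have hw0 : ∀ s < t, w s = 0 := by
    intro s hs
    have hconst : ∀ x ≤ s, w x = w s := by
      intro x hx
      have e1 : w x ≤ w s := mono_of_deriv hx
        (fun y hy => (h.cw (by linarith [hy.2])).continuousWithinAt)
        (fun y hy => h.hw y (by linarith [hy.2])) (fun y hy => (hw10 y (by linarith [hy.2])).ge)
      have e2 : -w x ≤ -w s := mono_of_deriv (f := fun x => - w x) hx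
        (fun y hy => (h.cw (by linarith [hy.2])).neg.continuousWithinAt)
        (fun y hy => (h.hw y (by linarith [hy.2])).neg)
        (fun y hy => by simp [(hw10 y (by linarith [hy.2]))])
      linarith
    have : Tendsto w atBot (𝓝 (w s)) := by
      refine tendsto_const_nhds.congr' ?_
      filter_upwards [eventually_le_atBot s] with x hx using (hconst x hx).symm
    exact tendsto_nhds_unique this h.limw
  have : (Iio t).Finite := Z.finite_toSet.subset (fun s hs => hZ s (lt_trans hs ht) (hw0 s hs))
  exact (Set.Iio_infinite t) this

variable {c q ω Ω B P : ℝ}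

lemma EF.small (h : EF σ b p w w1 E) (k : EFC σ b p c q ω Ω B P) {t : ℝ} 
    (hs : |w t| ≤ ω) : 2 * Ham b p w w1 t + c ^ 2 * w t ^ 2 ≤ w1 t ^ 2 := by
  have hp := h.hp
  have e : |w t| ^ (p - 1) ≤ ω ^ (p - 1) :=
    Real.rpow_le_rpow (abs_nonneg _) hs (by linarith)
  have h1 := k.h1
  have h2 : 2 * |w t| ^ (p - 1) / (p + 1) + c ^ 2 ≤ b := by
    refine le_trans ?_ h1
    gcongr
  unfold Ham
  rw [abs_rpow_split _ _ hp]
  have h3 := mul_le_mul_of_nonneg_right h2 (sq_nonneg (w t))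
  have e : 2 * (|w t| ^ (p - 1) * w t ^ 2 / (p + 1)) = 2 * |w t| ^ (p - 1) / (p + 1) * w t ^ 2 := by
    ring
  nlinarith

lemma EF.w1_bound (h : EF σ b p w w1 E) (k : EFC σ b p c q ω Ω B P) (t : ℝ) :
    w1 t ^ 2 ≤ 2 * Ham b p w w1 t + B * Ω ^ 2 ∧ (Ω ≤ |w t| → w t ^ 2 ≤ 2 * Ham b p w w1 t) := by
  have hp := h.hp
  have hΩ := k.hΩ
  have key : Ω ≤ |w t| → w t ^ 2 + w1 t ^ 2 ≤ 2 * Ham b p w w1 t := by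
    intro hs
    have e : Ω ^ (p - 1) ≤ |w t| ^ (p - 1) :=
      Real.rpow_le_rpow (by linarith) hs (by linarith)
    have h2 : b + 1 ≤ 2 * |w t| ^ (p - 1) / (p + 1) := by
      refine le_trans k.h3 ?_
      gcongr
    unfold Ham
    rw [abs_rpow_split _ _ hp]
    have h3 := mul_le_mul_of_nonneg_right h2 (sq_nonneg (w t))
    have e : 2 * (|w t| ^ (p - 1) * w t ^ 2 / (p + 1)) = 2 * |w t| ^ (p - 1) / (p + 1) * w t ^ 2 := by
      ring
    nlinarith
  refine ⟨?_, fun hs => by nlinarith [key hs, sq_nonneg (w1 t)]⟩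
  have hb := k.hb
  have hB := k.hB
  rcases le_total Ω |w t| with hs | hs
  · have : 0 ≤ B * Ω ^ 2 := mul_nonneg (by linarith) (sq_nonneg _)
    nlinarith [key hs, sq_nonneg (w t)]
  · have e1 : w t ^ 2 ≤ Ω ^ 2 := sq_le_sq' (by linarith [neg_abs_le (w t)]) (by linarith [le_abs_self (w t)])
    have e2 : b * w t ^ 2 ≤ B * Ω ^ 2 := mul_le_mul hB e1 (sq_nonneg _) (by linarith)
    have e3 : 0 ≤ |w t| ^ (p + 1) / (p + 1) := by
      have : 0 < p + 1 := by linarith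
      positivity
    unfold Ham
    nlinarith

/-- time spent in the region of large `w` -/
lemma EF.big_time (h : EF σ b p w w1 E) (k : EFC σ b p c q ω Ω B P) {s t : ℝ} (hst : s ≤ t)
    (ht : t < 0) (hbig : ∀ x ∈ Icc s t, ω ≤ |w x|) : t - s ≤ 2 * π / q := by
  have hq := k.hq
  have hω := k.hω
  have hp := h.hp
  have hw0 : ∀ x ∈ Icc s t, w x ≠ 0 := fun x hx h0 => by
    have := hbig x hx
    rw [h0, abs_zero] at this
    linarith
  set v : ℝ → ℝ := fun x => w1 x / w x / q with hv
  have hdv : ∀ x ∈ Icc s t, HasDerivAt (fun x => - arctan (v x) - q / 2 * x)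
      (-((σ * (w1 x / w x) + b - |w x| ^ (p - 1) - (w1 x / w x) ^ 2) / q / (1 + v x ^ 2)) - q / 2) x := by
    intro x hx
    have hx0 : x < 0 := by linarith [hx.2]
    have h1 := (((h.hw1 x hx0).div (h.hw x hx0) (hw0 x hx)).div_const q).arctan.neg.sub
      ((hasDerivAt_id x).const_mul (q / 2))
    refine h1.congr_deriv ?_
    have := hw0 x hx
    simp only [hv, mul_one]
    congr 2
    rw [one_div, inv_mul_eq_div]
    congr 2
    field_simp
  have := mono_of_deriv hst (fun x hx => (hdv x hx).continuousAt.continuousWithinAt)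
    (fun x hx => hdv x (Ioo_subset_Icc_self hx)) (fun x hx => by
      have hx' := Ioo_subset_Icc_self hx
      have e : ω ^ (p - 1) ≤ |w x| ^ (p - 1) :=
        Real.rpow_le_rpow hω.le (hbig x hx') (by linarith)
      have h2 := k.h2
      set y := w1 x / w x with hy
      have e2 : σ * y ≤ y ^ 2 / 2 + q ^ 2 / 2 := by
        have := k.hσq
        have := h.hσ
        nlinarith [sq_nonneg (y - σ)]
      have e3 : σ * y + b - |w x| ^ (p - 1) - y ^ 2 ≤ - (y ^ 2 + q ^ 2) / 2 := by linarith
      have e4 : v x = y / q := rfl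
      rw [e4, sub_nonneg, ← neg_div, ← neg_div, le_div_iff₀ (by positivity), le_div_iff₀ hq]
      have : q / 2 * (1 + (y / q) ^ 2) * q = (y ^ 2 + q ^ 2) / 2 := by
        field_simp
        ring
      rw [this]
      linarith)
  have a1 := arctan_lt_pi_div_two (v s)
  have a2 := neg_pi_div_two_lt_arctan (v t)
  rw [le_div_iff₀ hq]
  nlinarith

/-- integral bound on a piece where `0 < |w| < ω` -/
lemma EF.small_E (h : EF σ b p w w1 E) (k : EFC σ b p c q ω Ω B P) {s t : ℝ} (hst : s ≤ t)
    (ht : t < 0) (hs : ∀ x ∈ Ioo s t, |w x| < ω) (h0 : ∀ x ∈ Ioo s t, w x ≠ 0) (hsω : |w s| ≤ ω)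
    (htω : |w t| ≤ ω) :
    E t - E s ≤ exp (-σ * s) * ((P + 1) * B / 2 * ω ^ 2 / (2 * c)) := by
  have hp := h.hp
  have hc := k.hc
  have hω := k.hω
  have hb := k.hb
  set M := (P + 1) * B / 2 with hM
  have hMω : ω ^ (p - 1) ≤ M := by
    have h1 : 2 * ω ^ (p - 1) / (p + 1) ≤ b := by nlinarith [k.h1, sq_nonneg c]
    rw [div_le_iff₀ (by linarith)] at h1
    have : b * (p + 1) ≤ B * (P + 1) := mul_le_mul k.hB (by linarith [k.hP]) (by linarith) (by linarith [k.hB])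
    rw [hM]; linarith
  have hM0 : 0 ≤ M := le_trans (by positivity) hMω
  have hw1 : ∀ x ∈ Ioo s t, c ^ 2 * w x ^ 2 ≤ w1 x ^ 2 := fun x hx => by
    nlinarith [h.small k (hs x hx).le, h.H_nonneg (by linarith [hx.2] : x < 0)]
  have hne : ∀ x ∈ Ioo s t, w x * w1 x ≠ 0 := fun x hx => by
    refine mul_ne_zero (h0 x hx) (fun h1 => ?_)
    have := hw1 x hx
    have h2 := h0 x hx
    have : 0 < c ^ 2 * w x ^ 2 := by positivity
    rw [h1] at *
    linarith
  set L := exp (-σ * s) * M / (2 * c) with hL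
  have hL0 : 0 ≤ L := by positivity
  have hys : w s ^ 2 ≤ ω ^ 2 := sq_le_sq' (by linarith [neg_abs_le (w s)]) (by linarith [le_abs_self (w s)])
  have hyt : w t ^ 2 ≤ ω ^ 2 := sq_le_sq' (by linarith [neg_abs_le (w t)]) (by linarith [le_abs_self (w t)])
  have hgoal : exp (-σ * s) * (M * ω ^ 2 / (2 * c)) = L * ω ^ 2 := by rw [hL]; ring
  rw [hgoal]
  have hEd : ∀ x ∈ Ioo s t, exp (-σ * x) * |w x| ^ (p + 1) ≤ L * (2 * |w x * w1 x|) := by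
    intro x hx
    have e1 : exp (-σ * x) ≤ exp (-σ * s) := exp_le_exp.mpr (by nlinarith [h.hσ, hx.1])
    have e2 : |w x| ^ (p - 1) ≤ M := le_trans
      (Real.rpow_le_rpow (abs_nonneg _) (hs x hx).le (by linarith)) hMω
    have e3 : c * |w x| ≤ |w1 x| := by
      have h5 : (c * w x) ^ 2 ≤ w1 x ^ 2 := by rw [mul_pow]; exact hw1 x hx
      have := sq_le_sq.mp h5
      rwa [abs_mul, abs_of_pos hc] at this
    rw [abs_rpow_split _ _ hp, abs_mul, ← sq_abs (w x)]
    calc exp (-σ * x) * (|w x| ^ (p - 1) * |w x| ^ 2)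
        ≤ exp (-σ * s) * (M * |w x| ^ 2) := by gcongr
      _ = L * (2 * (|w x| * (c * |w x|))) := by rw [hL]; field_simp
      _ ≤ _ := by gcongr
  have hcw : ∀ x ∈ Icc s t, ContinuousAt w x := fun x hx => h.cw (by linarith [hx.2])
  have hcE : ∀ x ∈ Icc s t, ContinuousAt E x := fun x hx => (h.hE x (by linarith [hx.2])).continuousAt
  rcases sign_const (f := fun x => w x * w1 x) (fun x hx => ((h.cw (by linarith [hx.2])).mul
    (h.cw1 (by linarith [hx.2]))).continuousWithinAt) hne with hpos | hneg
  · have := mono_of_deriv (f := fun x => L * w x ^ 2 - E x) hst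
      (fun x hx => ((((hcw x hx).pow 2).const_mul L).sub (hcE x hx)).continuousWithinAt)
      (fun x hx => (((h.hw x (by linarith [hx.2])).pow 2).const_mul L).sub (h.hE x (by linarith [hx.2])))
      (fun x hx => by
        have e1 := hEd x hx
        rw [abs_of_pos (hpos x hx)] at e1
        simp only [Nat.cast_ofNat, Nat.add_one_sub_one, pow_one]
        linarith)
    nlinarith [sq_nonneg (w s)]
  · have := mono_of_deriv (f := fun x => -(L * w x ^ 2) - E x) hst
      (fun x hx => ((((hcw x hx).pow 2).const_mul L).neg.sub (hcE x hx)).continuousWithinAt)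
      (fun x hx => (((h.hw x (by linarith [hx.2])).pow 2).const_mul L).neg.sub (h.hE x (by linarith [hx.2])))
      (fun x hx => by
        have e1 := hEd x hx
        rw [abs_of_neg (hneg x hx)] at e1
        simp only [Nat.cast_ofNat, Nat.add_one_sub_one, pow_one]
        linarith)
    nlinarith [sq_nonneg (w t)]

lemma EF.small_time (h : EF σ b p w w1 E) (k : EFC σ b p c q ω Ω B P) {s t g : ℝ} (hst : s ≤ t)
    (ht : t < 0) (hs : ∀ x ∈ Ioo s t, |w x| < ω) (hsω : |w s| ≤ ω)
    (htω : |w t| ≤ ω) (hg : 0 < g) (hH : ∀ x ∈ Ioo s t, g ^ 2 ≤ 2 * Ham b p w w1 x) :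
    t - s ≤ 2 * ω / g := by
  have hg1 : ∀ x ∈ Ioo s t, g ≤ |w1 x| := by
    intro x hx
    have := h.small k (hs x hx).le
    have h2 : g ^ 2 ≤ w1 x ^ 2 := by nlinarith [hH x hx, sq_nonneg (c * w x)]
    have := sq_le_sq.mp h2
    rwa [abs_of_pos hg] at this
  have hne : ∀ x ∈ Ioo s t, w1 x ≠ 0 := fun x hx h0 => by
    have := hg1 x hx
    rw [h0, abs_zero] at this
    linarith
  have hcw : ∀ x ∈ Icc s t, ContinuousAt w x := fun x hx => h.cw (by linarith [hx.2])
  rw [le_div_iff₀ hg]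
  have a1 := abs_le.mp hsω
  have a2 := abs_le.mp htω
  rcases sign_const (f := w1) (fun x hx => 
    (h.cw1 (by linarith [hx.2])).continuousWithinAt) hne with hpos | hneg
  · have := mono_of_deriv (f := fun x => w x - g * x) hst
      (fun x hx => ((hcw x hx).sub (continuousAt_id.const_mul g)).continuousWithinAt)
      (fun x hx => (h.hw x (by linarith [hx.2])).sub ((hasDerivAt_id x).const_mul g))
      (fun x hx => by
        have e1 := hg1 x hx
        rw [abs_of_pos (hpos x hx)] at e1
        linarith)
    nlinarith
  · have := mono_of_deriv (f := fun x => -w x - g * x) hst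
      (fun x hx => ((hcw x hx).neg.sub (continuousAt_id.const_mul g)).continuousWithinAt)
      (fun x hx => (h.hw x (by linarith [hx.2])).neg.sub ((hasDerivAt_id x).const_mul g))
      (fun x hx => by
        have e1 := hg1 x hx
        rw [abs_of_neg (hneg x hx)] at e1
        linarith)
    nlinarith

lemma EF.endpt (h : EF σ b p w w1 E) {s t : ℝ} (hst : s < t)
    (ht : t < 0) (hs : ∀ x ∈ Ioo s t, |w x| < ω) : |w s| ≤ ω ∧ |w t| ≤ ω := by
  have hcl : closure (Ioo s t) = Icc s t := closure_Ioo hst.ne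
  have key : ∀ x ∈ Icc s t, |w x| ≤ ω := by
    intro x hx
    have hx' : x ∈ closure (Ioo s t) := by rw [hcl]; exact hx
    have hc : ContinuousWithinAt (fun x => |w x|) (Ioo s t) x :=
      (h.cw (by linarith [hx.2])).abs.continuousWithinAt
    exact hc.closure_le hx' continuousWithinAt_const (fun y hy => (hs y hy).le)
  exact ⟨key s (left_mem_Icc.mpr hst.le), key t (right_mem_Icc.mpr hst.le)⟩

lemma EF.small_E' (h : EF σ b p w w1 E) (k : EFC σ b p c q ω Ω B P) {s t : ℝ} (hst : s ≤ t)
    (ht : t < 0) (hs : ∀ x ∈ Ioo s t, |w x| < ω) (h0 : ∀ x ∈ Ioo s t, w x ≠ 0) :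
    E t - E s ≤ exp (-σ * s) * ((P + 1) * B / 2 * ω ^ 2 / (2 * c)) := by
  rcases hst.eq_or_lt with rfl | hlt
  · have := k.hc
    have := k.hb
    have := k.hB
    have := k.hP
    have := h.hp
    have hB : 0 < B := by linarith
    have hP : 0 < P + 1 := by linarith
    rw [sub_self]
    positivity
  · obtain ⟨a1, a2⟩ := h.endpt hlt ht hs
    exact h.small_E k hst ht hs h0 a1 a2

lemma EF.small_time' (h : EF σ b p w w1 E) (k : EFC σ b p c q ω Ω B P) {s t g : ℝ} (hst : s ≤ t)
    (ht : t < 0) (hs : ∀ x ∈ Ioo s t, |w x| < ω) 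
    (hg : 0 < g) (hH : ∀ x ∈ Ioo s t, g ^ 2 ≤ 2 * Ham b p w w1 x) :
    t - s ≤ 2 * ω / g := by
  rcases hst.eq_or_lt with rfl | hlt
  · have := k.hω
    rw [sub_self]
    positivity
  · obtain ⟨a1, a2⟩ := h.endpt hlt ht hs
    exact h.small_time k hst ht hs a1 a2 hg hH

lemma EF.struct (h : EF σ b p w w1 E) (k : EFC σ b p c q ω Ω B P) {s t : ℝ} (hst : s ≤ t)
    (ht : t < 0) (h0 : ∀ x ∈ Ioo s t, w x ≠ 0) (hH : ∀ x ∈ Icc s t, 0 < Ham b p w w1 x) :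
    ∃ ta tb, s ≤ ta ∧ ta ≤ tb ∧ tb ≤ t ∧ (∀ x ∈ Ioo s ta, |w x| < ω) ∧
      (∀ x ∈ Ioo tb t, |w x| < ω) ∧ ((∀ x ∈ Icc ta tb, ω ≤ |w x|) ∨ ta = tb) := by
  set S := {x | x ∈ Icc s t ∧ ω ≤ |w x|} with hS
  have hcont : ContinuousOn (fun x => |w x|) (Icc s t) :=
    fun x hx => (h.cw (by linarith [hx.2])).abs.continuousWithinAt
  have hScl : IsClosed S := by
    have := hcont.preimage_isClosed_of_isClosed isClosed_Icc (isClosed_Ici (a := ω))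
    exact this
  have hScomp : IsCompact S := isCompact_Icc.of_isClosed_subset hScl (fun x hx => hx.1)
  rcases S.eq_empty_or_nonempty with hemp | hne
  · refine ⟨t, t, hst, le_rfl, le_rfl, fun x hx => ?_, fun x hx => absurd hx (by simp), Or.inr rfl⟩
    by_contra! hcon
    have : x ∈ S := ⟨Ioo_subset_Icc_self hx, hcon⟩
    rw [hemp] at this
    exact this
  obtain ⟨ta, hta⟩ := hScomp.exists_isLeast hne
  obtain ⟨tb, htb⟩ := hScomp.exists_isGreatest hne
  refine ⟨ta, tb, hta.1.1.1, hta.2 htb.1, htb.1.1.2, fun x hx => ?_, fun x hx => ?_, Or.inl ?_⟩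
  · by_contra! hcon
    have := hta.2 (show x ∈ S from ⟨⟨hx.1.le, by linarith [hx.2, hta.1.1.2]⟩, hcon⟩)
    linarith [hx.2]
  · by_contra! hcon
    have := htb.2 (show x ∈ S from ⟨⟨by linarith [hx.1, htb.1.1.1], hx.2.le⟩, hcon⟩)
    linarith [hx.1]
  · intro x hx
    by_contra! hcon
    have hab : ta ≤ tb := hta.2 htb.1
    have hcont2 : ContinuousOn (fun x => |w x|) (Icc ta tb) :=
      hcont.mono (Icc_subset_Icc hta.1.1.1 htb.1.1.2)
    obtain ⟨x0, hx0, hmin⟩ := isCompact_Icc.exists_isMinOn ⟨x, hx⟩ hcont2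
    have hx0ω : |w x0| < ω := lt_of_le_of_lt (hmin hx) hcon
    have hxa : ta < x0 := lt_of_le_of_ne hx0.1 (fun e => by
      have := hta.1.2; rw [e] at this; linarith)
    have hxb : x0 < tb := lt_of_le_of_ne hx0.2 (fun e => by
      have := htb.1.2; rw [← e] at this; linarith)
    have hx00 : x0 < 0 := by linarith [htb.1.1.2]
    have hloc : IsLocalMin (fun x => w x ^ 2) x0 := by
      filter_upwards [Icc_mem_nhds hxa hxb] with y hy
      exact sq_le_sq.mpr (hmin hy)
    have hd := hloc.hasDerivAt_eq_zero ((h.hw x0 hx00).pow 2)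
    have hwne := h0 x0 ⟨by linarith [hta.1.1.1], by linarith [htb.1.1.2]⟩
    have hw1 : w1 x0 = 0 := by simpa [hwne] using hd
    have hsm := h.small k hx0ω.le
    have hHp := hH x0 ⟨by linarith [hta.1.1.1], by linarith [htb.1.1.2]⟩
    rw [hw1] at hsm
    nlinarith [sq_nonneg (c * w x0)]

lemma EF.nodal_time (h : EF σ b p w w1 E) (k : EFC σ b p c q ω Ω B P) {s t g : ℝ} (hst : s ≤ t)
    (ht : t < 0) (h0 : ∀ x ∈ Ioo s t, w x ≠ 0) (hg : 0 < g)
    (hH : ∀ x ∈ Icc s t, g ^ 2 ≤ 2 * Ham b p w w1 x) :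
    t - s ≤ 2 * (2 * ω / g) + 2 * π / q := by
  obtain ⟨ta, tb, h1, h2, h3, h4, h5, h6⟩ := h.struct k hst ht h0
    (fun x hx => by nlinarith [hH x hx, pow_pos hg 2])
  have e1 := h.small_time' k h1 (by linarith) h4 hg
    (fun x hx => hH x ⟨hx.1.le, by linarith [hx.2]⟩)
  have e2 := h.small_time' k h3 (by linarith) h5 hg
    (fun x hx => hH x ⟨by linarith [hx.1], hx.2.le⟩)
  have e3 : tb - ta ≤ 2 * π / q := by
    rcases h6 with h6 | h6
    · exact h.big_time k h2 (by linarith) h6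
    · have := k.hq
      rw [h6, sub_self]; positivity
  linarith

lemma EF.nodal_E (h : EF σ b p w w1 E) (k : EFC σ b p c q ω Ω B P) {s t W : ℝ} (hst : s ≤ t)
    (ht : t < 0) (h0 : ∀ x ∈ Ioo s t, w x ≠ 0)
    (hH : ∀ x ∈ Icc s t, 0 < Ham b p w w1 x) (hW1 : 1 ≤ W) (hW : ∀ x ∈ Icc s t, |w x| ≤ W) :
    E t - E s ≤ exp (-σ * s) * (2 * ((P + 1) * B / 2 * ω ^ 2 / (2 * c)) +
      2 * π / q * W ^ (P + 1)) := by
  obtain ⟨ta, tb, h1, h2, h3, h4, h5, h6⟩ := h.struct k hst ht h0 hH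
  have hc := k.hc
  have hq := k.hq
  have hσ := h.hσ
  have hp := h.hp
  have hP := k.hP
  have e1 := h.small_E' k h1 (by linarith) h4 (fun x hx => h0 x ⟨hx.1, by linarith [hx.2]⟩)
  have e2 := h.small_E' k h3 (by linarith) h5 (fun x hx => h0 x ⟨by linarith [hx.1], hx.2⟩)
  have hC1 : 0 ≤ (P + 1) * B / 2 * ω ^ 2 / (2 * c) := by
    have := k.hb
    have := k.hB
    have hB : 0 < B := by linarith
    have hP : 0 < P + 1 := by linarith
    positivity
  set C1 := (P + 1) * B / 2 * ω ^ 2 / (2 * c)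
  have e2' : exp (-σ * tb) * C1 ≤ exp (-σ * s) * C1 := by
    refine mul_le_mul_of_nonneg_right (exp_le_exp.mpr ?_) hC1
    nlinarith
  have e3 : tb - ta ≤ 2 * π / q := by
    rcases h6 with h6 | h6
    · exact h.big_time k h2 (by linarith) h6
    · rw [h6, sub_self]; positivity
  have e4 : E tb - E ta ≤ exp (-σ * s) * W ^ (P + 1) * (tb - ta) := by
    have := mono_of_deriv (f := fun x => exp (-σ * s) * W ^ (P + 1) * x - E x) h2
      (fun x hx => ((continuousAt_id.const_mul _).sub
        (h.hE x (by linarith [hx.2])).continuousAt).continuousWithinAt)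
      (fun x hx => ((hasDerivAt_id x).const_mul _).sub (h.hE x (by linarith [hx.2])))
      (fun x hx => by
        have e5 : exp (-σ * x) ≤ exp (-σ * s) := exp_le_exp.mpr (by nlinarith [hx.1])
        have e6 : |w x| ^ (p + 1) ≤ W ^ (P + 1) :=
          le_trans (Real.rpow_le_rpow (abs_nonneg _)
            (hW x ⟨by linarith [hx.1], by linarith [hx.2]⟩) (by linarith))
            (Real.rpow_le_rpow_of_exponent_le hW1 (by linarith))
        rw [mul_one, sub_nonneg]
        gcongr)
    nlinarith
  have e5 : exp (-σ * s) * W ^ (P + 1) * (tb - ta) ≤ exp (-σ * s) * W ^ (P + 1) * (2 * π / q) := by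
    gcongr
  linarith

end

lemma count_bound (φ : ℝ → ℝ) (M A : ℝ) (hM : 0 ≤ M) (Z : Finset ℝ) (T : ℝ)
    (hφ : ∀ s t, A ≤ s → s ≤ t → t ≤ T → (∀ x ∈ Ioo s t, x ∉ Z) → φ t - φ s ≤ M) :
    ∀ k : ℕ, ∀ s t, A ≤ s → s ≤ t → t ≤ T → (Z.filter (fun x => x ∈ Ioo s t)).card ≤ k →
      φ t - φ s ≤ (k + 1) * M := by
  classical
  intro k
  induction k using Nat.strong_induction_on with
  | _ k ih =>
    intro s t hA hst hT hk
    by_cases hz : ∀ x ∈ Ioo s t, x ∉ Z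
    · have := hφ s t hA hst hT hz
      have : (0:ℝ) ≤ k * M := by positivity
      linarith
    · push Not at hz
      obtain ⟨z, hz, hzZ⟩ := hz
      set a := (Z.filter (fun x => x ∈ Ioo s z)).card with ha
      set d := (Z.filter (fun x => x ∈ Ioo z t)).card with hd
      have hle : a + d + 1 ≤ k := by
        refine le_trans ?_ hk
        have hdis : Disjoint (Z.filter (fun x => x ∈ Ioo s z)) (Z.filter (fun x => x ∈ Ioo z t)) := by
          rw [Finset.disjoint_left]
          intro x hx hx'
          simp only [Finset.mem_filter, mem_Ioo] at hx hx'
          linarith [hx.2.2, hx'.2.1]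
        have hz' : z ∉ Z.filter (fun x => x ∈ Ioo s z) ∪ Z.filter (fun x => x ∈ Ioo z t) := by
          simp
        rw [ha, hd, ← Finset.card_union_of_disjoint hdis, ← Finset.card_insert_of_notMem hz']
        refine Finset.card_le_card ?_
        intro x hx
        simp only [Finset.mem_insert, Finset.mem_union, Finset.mem_filter, mem_Ioo] at hx ⊢
        rcases hx with rfl | hx | hx
        · exact ⟨hzZ, hz⟩
        · exact ⟨hx.1, hx.2.1, by linarith [hx.2.2, hz.2]⟩
        · exact ⟨hx.1, by linarith [hx.2.1, hz.1], hx.2.2⟩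
      have e1 := ih a (by omega) s z hA hz.1.le (by linarith [hz.2]) le_rfl
      have e2 := ih d (by omega) z t (by linarith [hz.1]) hz.2.le hT le_rfl
      have e3 : ((a:ℝ) + d + 1) ≤ k := by exact_mod_cast hle
      nlinarith

section
variable {σ b p : ℝ} {w w1 E : ℝ → ℝ} {c q ω Ω B P : ℝ}

lemma le_lim_of_anti {f : ℝ → ℝ} {t l : ℝ} (hl : Tendsto f atBot (𝓝 l))
    (h : ∀ s < t, f s ≤ f t) : l ≤ f t := by
  refine le_of_tendsto hl ?_
  filter_upwards [eventually_lt_atBot t] with s hs using h s hs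

lemma EF.first_sign (h : EF σ b p w w1 E) (k : EFC σ b p c q ω Ω B P) {t0 : ℝ} (ht : t0 < 0)
    (hs : ∀ x < t0, |w x| < ω) (hH : ∀ x < 0, 0 < Ham b p w w1 x) :
    ((∀ x < t0, 0 < w1 x) ∨ (∀ x < t0, w1 x < 0)) ∧ ∀ x < t0, 0 ≤ w x * w1 x := by
  have hne : ∀ x < t0, w1 x ≠ 0 := fun x hx h0 => by
    have := h.small k (hs x hx).le
    rw [h0] at this
    nlinarith [hH x (by linarith), sq_nonneg (c * w x)]
  have hsgn : (∀ x < t0, 0 < w1 x) ∨ (∀ x < t0, w1 x < 0) := by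
    by_contra! hcon
    obtain ⟨⟨x, hx, hx0⟩, ⟨y, hy, hy0⟩⟩ := hcon
    have := (isPreconnected_Iio (a := t0)).intermediate_value (f := w1) hx hy
      (fun z hz => (h.cw1 (lt_trans hz ht)).continuousWithinAt)
    obtain ⟨z, hz, hz0⟩ := this ⟨hx0, hy0⟩
    exact hne z hz hz0
  refine ⟨hsgn, fun x hx => ?_⟩
  rcases hsgn with hp | hn
  · have : 0 ≤ w x := le_lim_of_anti h.limw (fun s hs => mono_of_deriv hs.le
      (fun y hy => (h.cw (by linarith [hy.2])).continuousWithinAt)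
      (fun y hy => h.hw y (by linarith [hy.2])) (fun y hy => (hp y (by linarith [hy.2])).le))
    exact mul_nonneg this (hp x hx).le
  · have : 0 ≤ -w x := le_lim_of_anti (f := fun x => - w x) (by simpa using h.limw.neg)
      (fun s hs => mono_of_deriv (f := fun x => - w x) hs.le
      (fun y hy => (h.cw (by linarith [hy.2])).neg.continuousWithinAt)
      (fun y hy => (h.hw y (by linarith [hy.2])).neg)
      (fun y hy => by linarith [hn y (by linarith [hy.2])]))
    nlinarith [hn x hx]

lemma EF.first (h : EF σ b p w w1 E) (k : EFC σ b p c q ω Ω B P) {t0 : ℝ} (ht : t0 < 0)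
    (hs : ∀ x < t0, |w x| < ω) (hH : ∀ x < 0, 0 < Ham b p w w1 x) :
    E t0 ≤ ((P + 1) * B / 2) / c * (exp (-σ * t0) * ω ^ 2) ∧
    σ * c / 2 * w t0 ^ 2 ≤ Ham b p w w1 t0 ∧
    Ham b p w w1 t0 ≤ 2 * ω ^ 2 + B * Ω ^ 2 := by
  obtain ⟨hsgn, hww⟩ := h.first_sign k ht hs hH
  have hc := k.hc
  have hp := h.hp
  have hω := k.hω
  have hσ := h.hσ
  have hb := k.hb
  have hB : 0 < B := by linarith [k.hB]
  have hcw : ∀ x < t0, c * |w x| ≤ |w1 x| := by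
    intro x hx
    have h5 : (c * w x) ^ 2 ≤ w1 x ^ 2 := by
      rw [mul_pow]
      linarith [h.small k (hs x hx).le, hH x (by linarith)]
    have := sq_le_sq.mp h5
    rwa [abs_mul, abs_of_pos hc] at this
  have habs : ∀ x < t0, w x * w1 x = |w x| * |w1 x| := fun x hx => by
    rw [← abs_mul, abs_of_nonneg (hww x hx)]
  have hwt : |w t0| ≤ ω := (h.endpt (s := t0 - 1) (by linarith) ht (fun x hx => hs x hx.2)).2
  have hyt : w t0 ^ 2 ≤ ω ^ 2 := sq_le_sq' (by linarith [neg_abs_le (w t0)]) (by linarith [le_abs_self (w t0)])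
  refine ⟨?_, ?_, ?_⟩
  · set M := (P + 1) * B / 2 with hM
    have hMω : ω ^ (p - 1) ≤ M := by
      have h1 : 2 * ω ^ (p - 1) / (p + 1) ≤ b := by nlinarith [k.h1, sq_nonneg c]
      rw [div_le_iff₀ (by linarith)] at h1
      have : b * (p + 1) ≤ B * (P + 1) := mul_le_mul k.hB (by linarith [k.hP]) (by linarith) (by linarith [k.hB])
      rw [hM]; linarith
    have hM0 : 0 ≤ M := le_trans (by positivity) hMω
    have hexp : ∀ x, HasDerivAt (fun x => exp (-σ * x)) (exp (-σ * x) * -σ) x := fun x => by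
      have := ((hasDerivAt_id x).const_mul (-σ)).exp
      simpa using this
    have hmono : ∀ s < t0, M / c * (exp (-σ * s) * w s ^ 2) - E s ≤
        M / c * (exp (-σ * t0) * w t0 ^ 2) - E t0 := by
      intro s hst
      have hd : ∀ x ≤ t0, HasDerivAt (fun x => M / c * (exp (-σ * x) * w x ^ 2) - E x) _ x :=
        fun x hx => ((((hexp x).mul ((h.hw x (by linarith)).pow 2)).const_mul (M / c)).sub
          (h.hE x (by linarith)))
      refine mono_of_deriv hst.le (fun x hx => (hd x hx.2).continuousAt.continuousWithinAt)
        (fun x hx => hd x hx.2.le) (fun x hx => ?_)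
      simp only [Nat.cast_ofNat, Nat.add_one_sub_one, pow_one]
      have e2 : |w x| ^ (p - 1) ≤ M := le_trans
        (Real.rpow_le_rpow (abs_nonneg _) (hs x hx.2).le (by linarith)) hMω
      have e3 : c * w x ^ 2 ≤ w x * w1 x := by
        rw [habs x hx.2, ← sq_abs]
        nlinarith [hcw x hx.2, abs_nonneg (w x)]
      rw [abs_rpow_split _ _ hp]
      have e4 : |w x| ^ (p - 1) * w x ^ 2 ≤ M * w x ^ 2 := by gcongr
      have e5 : c * w x ^ 2 ≤ 2 * (w x * w1 x) - σ * w x ^ 2 := by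
        nlinarith [k.hσc, sq_nonneg (w x)]
      have e6 : M * w x ^ 2 ≤ M / c * (2 * (w x * w1 x) - σ * w x ^ 2) := by
        have : M * w x ^ 2 = M / c * (c * w x ^ 2) := by field_simp
        rw [this]
        gcongr
      have e7 := mul_le_mul_of_nonneg_left (e4.trans e6) (exp_pos (-σ * x)).le
      simp only [Pi.pow_apply]
      nlinarith
    have := ge_of_tendsto (f := fun s => E s) (b := E t0 - M / c * (exp (-σ * t0) * w t0 ^ 2))
      h.limE (by
        filter_upwards [eventually_lt_atBot t0] with s hs'
        have := hmono s hs'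
        have : 0 ≤ M / c * (exp (-σ * s) * w s ^ 2) := by positivity
        linarith)
    have : M / c * (exp (-σ * t0) * w t0 ^ 2) ≤ M / c * (exp (-σ * t0) * ω ^ 2) := by gcongr
    linarith
  · have := le_lim_of_anti (f := fun x => Ham b p w w1 x - σ * c / 2 * w x ^ 2) (t := t0) (l := 0)
      (by simpa using h.limH.sub ((h.limw.pow 2).const_mul (σ * c / 2)))
      (fun s hst => by
        have hd : ∀ x ≤ t0, HasDerivAt (fun x => Ham b p w w1 x - σ * c / 2 * w x ^ 2) _ x :=
          fun x hx => (h.hH (by linarith)).sub (((h.hw x (by linarith)).pow 2).const_mul (σ * c / 2))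
        refine mono_of_deriv hst.le (fun x hx => (hd x hx.2).continuousAt.continuousWithinAt)
          (fun x hx => hd x hx.2.le) (fun x hx => ?_)
        simp only [Nat.cast_ofNat, Nat.add_one_sub_one, pow_one]
        have e1 : c * (w x * w1 x) ≤ w1 x ^ 2 := by
          rw [habs x hx.2, ← sq_abs (w1 x)]
          nlinarith [hcw x hx.2, abs_nonneg (w1 x)]
        nlinarith)
    linarith
  · set K := B * Ω ^ 2 with hK
    have hK0 : 0 ≤ K := by positivity
    set H0 := Ham b p w w1 t0 with hH0
    have hH0p : 0 < H0 := hH t0 ht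
    set A := √(2 * H0 + K) with hA
    have hA0 : 0 ≤ A := Real.sqrt_nonneg _
    have hA2 : A ^ 2 = 2 * H0 + K := Real.sq_sqrt (by linarith)
    have hw1A : ∀ x < t0, |w1 x| ≤ A := by
      intro x hx
      refine Real.abs_le_sqrt ?_
      linarith [(h.w1_bound k x).1, h.H_mono hx.le ht]
    have hle : H0 ≤ σ * A * ω := by
      have a1 := abs_le.mp hwt
      rcases hsgn with hpos | hneg
      · have := le_lim_of_anti (f := fun x => σ * A * w x - Ham b p w w1 x) (t := t0) (l := 0)
          (by simpa using (h.limw.const_mul (σ * A)).sub h.limH)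
          (fun s hst => by
            have hd : ∀ x ≤ t0, HasDerivAt (fun x => σ * A * w x - Ham b p w w1 x) _ x :=
              fun x hx => ((h.hw x (by linarith)).const_mul (σ * A)).sub (h.hH (by linarith))
            refine mono_of_deriv hst.le (fun x hx => (hd x hx.2).continuousAt.continuousWithinAt)
              (fun x hx => hd x hx.2.le) (fun x hx => ?_)
            have e1 := hw1A x hx.2
            rw [abs_of_pos (hpos x hx.2)] at e1
            have := mul_nonneg hσ.le (mul_nonneg (sub_nonneg.mpr e1) (hpos x hx.2).le)
            nlinarith)
        have h5 : σ * A * w t0 ≤ σ * A * ω := by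
          have : 0 ≤ σ * A := by positivity
          exact mul_le_mul_of_nonneg_left a1.2 this
        linarith
      · have := le_lim_of_anti (f := fun x => -(σ * A * w x) - Ham b p w w1 x) (t := t0) (l := 0)
          (by simpa using ((h.limw.const_mul (σ * A)).neg).sub h.limH)
          (fun s hst => by
            have hd : ∀ x ≤ t0, HasDerivAt (fun x => -(σ * A * w x) - Ham b p w w1 x) _ x :=
              fun x hx => ((h.hw x (by linarith)).const_mul (σ * A)).neg.sub (h.hH (by linarith))
            refine mono_of_deriv hst.le (fun x hx => (hd x hx.2).continuousAt.continuousWithinAt)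
              (fun x hx => hd x hx.2.le) (fun x hx => ?_)
            have e1 := hw1A x hx.2
            rw [abs_of_neg (hneg x hx.2)] at e1
            have := mul_nonneg hσ.le (mul_nonneg (sub_nonneg.mpr e1) (neg_nonneg.mpr (hneg x hx.2).le))
            nlinarith)
        have h5 : σ * A * (-w t0) ≤ σ * A * ω := by
          have : 0 ≤ σ * A := by positivity
          exact mul_le_mul_of_nonneg_left (by linarith) this
        linarith
    have hle2 : H0 ≤ A * ω := by
      have : σ * (A * ω) ≤ 1 * (A * ω) := mul_le_mul_of_nonneg_right k.hσ1 (by positivity)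
      linarith
    have hsq : H0 ^ 2 ≤ (2 * H0 + K) * ω ^ 2 := by
      rw [← hA2, ← mul_pow]
      exact pow_le_pow_left₀ hH0p.le hle2 2
    by_contra! hcon
    have hω2 : 0 < ω ^ 2 := by positivity
    have e1 : H0 * (2 * ω ^ 2 + K) < H0 * H0 := mul_lt_mul_of_pos_left hcon hH0p
    have e2 : 0 ≤ K * (H0 - ω ^ 2) := mul_nonneg hK0 (by linarith)
    nlinarith

end

set_option maxHeartbeats 1000000 in
theorem EF_main (N : ℕ) (c q ω Ω B P : ℝ) : ∃ C : ℝ, ∀ (σ b p : ℝ) (w w1 E : ℝ → ℝ) (Z : Finset ℝ),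
    EF σ b p w w1 E → EFC σ b p c q ω Ω B P → Z.card ≤ N → (∀ t < 0, w t = 0 → t ∈ Z) →
    ∀ t, -1 < t → t < 0 → E t ≤ C := by
  set Λ : ℝ := (N + 1) * (4 + 2 * π) + 1 with hΛ
  set K := B * Ω ^ 2 with hK
  set Hm := exp (2 * Λ) * ((2 * ω ^ 2 + K) + K / 2) with hHm
  set W := Ω + 2 * Hm + 1 with hW
  set M := (P + 1) * B / 2 with hM
  set D := 2 * (M * ω ^ 2 / (2 * c)) + 2 * π / q * W ^ (P + 1) with hD
  refine ⟨M / c * (exp Λ * ω ^ 2) + (N + 1) * (exp Λ * D), ?_⟩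
  intro σ b p w w1 E Z h k hZN hZ t ht1 ht
  have hHpos : ∀ x < 0, 0 < Ham b p w w1 x := fun x hx => h.H_pos Z hZ hx
  have hc := k.hc
  have hq := k.hq
  have hp := h.hp
  have hω := k.hω
  have hσ := h.hσ
  have hσ1 := k.hσ1
  have hb := k.hb
  have hΩ := k.hΩ
  have hB : 0 < B := by linarith [k.hB]
  have hP : 0 < P + 1 := by linarith [k.hP]
  have hK0 : 0 ≤ K := by positivity
  have hHm0 : 0 ≤ Hm := by positivity
  have hW1 : 1 ≤ W := by linarith
  have hM0 : 0 ≤ M := by positivity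
  have hD0 : 0 ≤ D := by positivity
  have hΛ1 : 1 ≤ Λ := by
    have : 0 ≤ (N + 1) * (4 + 2 * π) := by positivity
    linarith
  have hNN : 0 ≤ (N + 1) * (exp Λ * D) := by positivity
  by_cases hex : ∀ x < t, |w x| < ω
  · have e1 := (h.first k ht hex hHpos).1
    have e2 : exp (-σ * t) ≤ exp Λ := exp_le_exp.mpr (by nlinarith)
    have : M / c * (exp (-σ * t) * ω ^ 2) ≤ M / c * (exp Λ * ω ^ 2) := by gcongr
    linarith
  push Not at hex
  obtain ⟨x1, hx1, hx1ω⟩ := hex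
  obtain ⟨L, hL⟩ : ∃ L, ∀ x ≤ L, |w x| < ω := by
    have := (h.limw.abs).eventually_lt_const (u := ω) (by simpa using hω)
    exact eventually_atBot.mp this
  set S := {x | x ∈ Icc L t ∧ ω ≤ |w x|} with hS
  have hScl : IsClosed S := by
    have hcont : ContinuousOn (fun x => |w x|) (Icc L t) :=
      fun x hx => (h.cw (by linarith [hx.2])).abs.continuousWithinAt
    exact hcont.preimage_isClosed_of_isClosed isClosed_Icc (isClosed_Ici (a := ω))
  have hScomp : IsCompact S := isCompact_Icc.of_isClosed_subset hScl (fun x hx => hx.1)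
  obtain ⟨t0, ht0⟩ := hScomp.exists_isLeast ⟨x1, ⟨by
    by_contra! hcon
    have := hL x1 hcon.le
    linarith, hx1.le⟩, hx1ω⟩
  have ht0t : t0 ≤ t := ht0.1.1.2
  have ht00 : t0 < 0 := by linarith
  have hfirst : ∀ x < t0, |w x| < ω := by
    intro x hx
    by_contra! hcon
    have : L ≤ x := by
      by_contra! hcon2
      have := hL x hcon2.le
      linarith
    have := ht0.2 (show x ∈ S from ⟨⟨this, by linarith⟩, hcon⟩)
    linarith
  obtain ⟨f1, f2, f3⟩ := h.first k ht00 hfirst hHpos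
  have hwt0 : ω ^ 2 ≤ w t0 ^ 2 := by
    rw [← sq_abs (w t0)]
    exact pow_le_pow_left₀ hω.le ht0.1.2 2
  have hg : ∀ x, t0 ≤ x → x < 0 → (σ * ω) ^ 2 ≤ 2 * Ham b p w w1 x := by
    intro x hx hx0
    have e1 := h.H_mono hx hx0
    have e2 : σ * c / 2 * ω ^ 2 ≤ σ * c / 2 * w t0 ^ 2 := by gcongr
    have e3 : σ * ω ^ 2 * σ ≤ σ * ω ^ 2 * c := mul_le_mul_of_nonneg_left k.hσc (by positivity)
    nlinarith
  have hfil : (Z.filter (fun x => x ∈ Ioo t0 t)).card ≤ N := le_trans (Finset.card_filter_le _ _) hZN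
  -- time bound
  have htime : t - t0 ≤ (N + 1) * (2 * (2 * ω / (σ * ω)) + 2 * π / q) := by
    refine count_bound (fun x => x) _ t0 (by positivity) Z t ?_ N t0 t le_rfl ht0t le_rfl hfil
    intro s r hs hsr hr hz
    exact h.nodal_time k hsr (by linarith)
      (fun x hx h0 => hz x hx (hZ x (by linarith [hx.2]) h0)) (by positivity)
      (fun x hx => hg x (by linarith [hx.1]) (by linarith [hx.2]))
  have hσt : σ * (t - t0) ≤ (N + 1) * (4 + 2 * π) := by
    have e1 := mul_le_mul_of_nonneg_left htime hσ.le
    have e2 : σ * ((N + 1) * (2 * (2 * ω / (σ * ω)) + 2 * π / q)) =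
        (N + 1) * (4 + 2 * π * (σ / q)) := by
      field_simp
      ring
    rw [e2] at e1
    have e3 : σ / q ≤ 1 := (div_le_one hq).mpr k.hσq
    have e4 : (N + 1) * (4 + 2 * π * (σ / q)) ≤ (N + 1) * (4 + 2 * π * 1) := by gcongr
    linarith
  have hσt1 : σ * (-t) ≤ 1 := by
    have := mul_le_mul hσ1 (by linarith : -t ≤ 1) (by linarith) zero_le_one
    linarith
  have hσt0 : -σ * t0 ≤ Λ := by
    have : -σ * t0 = σ * (t - t0) + σ * (-t) := by ring
    linarith
  have hexpΛ : exp (-σ * t0) ≤ exp Λ := exp_le_exp.mpr hσt0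
  -- Gronwall
  have hHb : ∀ x, t0 ≤ x → x ≤ t → Ham b p w w1 x ≤ Hm := by
    intro x hx hxt
    have hexp : ∀ x, HasDerivAt (fun x => exp (-(2 * σ) * x)) (exp (-(2 * σ) * x) * -(2 * σ)) x :=
      fun x => by
        have := ((hasDerivAt_id x).const_mul (-(2 * σ))).exp
        simpa using this
    have hd : ∀ y ≤ x, HasDerivAt (fun y => -(exp (-(2 * σ) * y) * (Ham b p w w1 y + K / 2))) _ y :=
      fun y hy => ((hexp y).mul ((h.hH (by linarith)).add_const (K / 2))).neg
    have := mono_of_deriv hx (fun y hy => (hd y hy.2).continuousAt.continuousWithinAt)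
      (fun y hy => hd y hy.2.le) (fun y hy => by
        have e1 := (h.w1_bound k y).1
        have e2 := mul_nonneg (mul_nonneg hσ.le (exp_pos (-(2 * σ) * y)).le) (sub_nonneg.mpr e1)
        nlinarith)
    have e1 : Ham b p w w1 x + K / 2 = exp (2 * σ * x) * (exp (-(2 * σ) * x) * (Ham b p w w1 x + K / 2)) := by
      rw [← mul_assoc, ← exp_add]
      ring_nf
      simp
    have e2 : exp (2 * σ * x) * (exp (-(2 * σ) * x) * (Ham b p w w1 x + K / 2)) ≤
        exp (2 * σ * x) * (exp (-(2 * σ) * t0) * (Ham b p w w1 t0 + K / 2)) := by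
      refine mul_le_mul_of_nonneg_left (by linarith) (exp_pos _).le
    have e3 : exp (2 * σ * x) * (exp (-(2 * σ) * t0) * (Ham b p w w1 t0 + K / 2)) =
        exp (2 * (σ * (x - t0))) * (Ham b p w w1 t0 + K / 2) := by
      rw [← mul_assoc, ← exp_add]
      ring_nf
    have e4 : exp (2 * (σ * (x - t0))) ≤ exp (2 * Λ) := exp_le_exp.mpr (by
      have := mul_le_mul_of_nonneg_left (by linarith : x - t0 ≤ t - t0) hσ.le
      linarith)
    have e5 : exp (2 * (σ * (x - t0))) * (Ham b p w w1 t0 + K / 2) ≤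
        exp (2 * Λ) * ((2 * ω ^ 2 + K) + K / 2) := by
      have := hHpos t0 ht00
      gcongr
    linarith
  have hWb : ∀ x, t0 ≤ x → x ≤ t → |w x| ≤ W := by
    intro x hx hxt
    rcases le_total Ω |w x| with hs | hs
    · have e1 := (h.w1_bound k x).2 hs
      have e2 := hHb x hx hxt
      rw [← sq_abs] at e1
      nlinarith [sq_nonneg (|w x| - 1)]
    · linarith
  have hEb : E t - E t0 ≤ (N + 1) * (exp Λ * D) := by
    refine count_bound E _ t0 (by positivity) Z t ?_ N t0 t le_rfl ht0t le_rfl hfil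
    intro s r hs hsr hr hz
    have e1 := h.nodal_E k hsr (by linarith)
      (fun x hx h0 => hz x hx (hZ x (by linarith [hx.2]) h0))
      (fun x hx => hHpos x (by linarith [hx.2])) hW1
      (fun x hx => hWb x (by linarith [hx.1]) (by linarith [hx.2]))
    have e2 : exp (-σ * s) ≤ exp Λ := exp_le_exp.mpr (by
      have := mul_le_mul_of_nonneg_left hs hσ.le
      linarith)
    have e3 : exp (-σ * s) * D ≤ exp Λ * D := by gcongr
    linarith
  have : M / c * (exp (-σ * t0) * ω ^ 2) ≤ M / c * (exp Λ * ω ^ 2) := by gcongr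
  linarith

lemma params (ν : ℝ) (hν : 0 < ν) : ∃ c q ω Ω B P : ℝ, ∀ᶠ ε in 𝓝[>] (0:ℝ),
    EFC (2 * (2 / ((ν + 4) / ν - ε - 1)) - ν)
      (2 / ((ν + 4) / ν - ε - 1) * (ν - 2 / ((ν + 4) / ν - ε - 1)))
      ((ν + 4) / ν - ε) c q ω Ω B P := by
  set b0 := ν ^ 2 / 4 with hb0
  have hb0p : 0 < b0 := by positivity
  set p0 := (ν + 4) / ν with hp0
  have hp01 : p0 - 1 = 4 / ν := by rw [hp0]; field_simp; ring
  have hp01' : p0 + 1 = 2 * (ν + 2) / ν := by rw [hp0]; field_simp; ring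
  set ω : ℝ := ((ν + 1) / ν * b0) ^ (ν / 4) with hω
  set Ω : ℝ := ((ν + 2) / ν * (b0 + 2) + 1) ^ (ν / 4) with hΩ
  have hωp : 0 < ω := by positivity
  have hωpow : ω ^ (p0 - 1) = (ν + 1) / ν * b0 := by
    rw [hω, hp01, ← Real.rpow_mul (by positivity)]
    rw [show ν / 4 * (4 / ν) = 1 by field_simp, Real.rpow_one]
  have hΩpow : Ω ^ (p0 - 1) = (ν + 2) / ν * (b0 + 2) + 1 := by
    rw [hΩ, hp01, ← Real.rpow_mul (by positivity)]
    rw [show ν / 4 * (4 / ν) = 1 by field_simp, Real.rpow_one]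
  have hΩ1 : 1 ≤ Ω := by
    refine Real.one_le_rpow ?_ (by positivity)
    have : 0 ≤ (ν + 2) / ν * (b0 + 2) := by positivity
    linarith
  set c := √(b0 / (2 * (ν + 2))) with hc
  set q := √(b0 / (2 * ν)) with hq
  have hcp : 0 < c := Real.sqrt_pos.mpr (by positivity)
  have hqp : 0 < q := Real.sqrt_pos.mpr (by positivity)
  have hc2 : c ^ 2 = b0 / (2 * (ν + 2)) := Real.sq_sqrt (by positivity)
  have hq2 : q ^ 2 = b0 / (2 * ν) := Real.sq_sqrt (by positivity)
  set pf : ℝ → ℝ := fun ε => p0 - ε with hpf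
  set af : ℝ → ℝ := fun ε => 2 / (pf ε - 1) with haf
  set bf : ℝ → ℝ := fun ε => af ε * (ν - af ε) with hbf
  have hpf0 : pf 0 = p0 := by simp [hpf]
  have cpf : ContinuousAt pf 0 := by fun_prop
  have h4 : (0:ℝ) < 4 / ν := by positivity
  have haf0 : af 0 = ν / 2 := by
    simp only [haf, hpf0, hp01]; field_simp; norm_num
  have caf : ContinuousAt af 0 := by
    refine continuousAt_const.div (cpf.sub continuousAt_const) ?_
    rw [hpf0, hp01]; exact h4.ne'
  have hbf0 : bf 0 = b0 := by
    simp only [hbf, haf0, hb0]; ring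
  have cbf : ContinuousAt bf 0 := caf.mul (continuousAt_const.sub caf)
  have cωp : ContinuousAt (fun ε => ω ^ (pf ε - 1)) 0 :=
    continuousAt_const.rpow (cpf.sub continuousAt_const) (Or.inl hωp.ne')
  have cΩp : ContinuousAt (fun ε => Ω ^ (pf ε - 1)) 0 :=
    continuousAt_const.rpow (cpf.sub continuousAt_const) (Or.inl (by linarith))
  have hp0ne : pf 0 + 1 ≠ 0 := by rw [hpf0, hp01']; positivity
  have cpf1 : ContinuousAt (fun ε => pf ε + 1) 0 := cpf.add continuousAt_const
  have e1 : ∀ᶠ ε in 𝓝 (0:ℝ), 2 * ω ^ (pf ε - 1) / (pf ε + 1) + c ^ 2 < bf ε := by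
    refine ContinuousAt.eventually_lt (((cωp.const_mul 2).div cpf1 hp0ne).add continuousAt_const) cbf ?_
    simp only [hpf0, hbf0, hωpow, hp01', hc2]
    have : 2 * ((ν + 1) / ν * b0) / (2 * (ν + 2) / ν) + b0 / (2 * (ν + 2)) =
      b0 - b0 / (2 * (ν + 2)) := by field_simp; ring
    show 2 * ((ν + 1) / ν * b0) / (2 * (ν + 2) / ν) + b0 / (2 * (ν + 2)) < b0
    rw [this]
    have : 0 < b0 / (2 * (ν + 2)) := by positivity
    linarith
  have e2 : ∀ᶠ ε in 𝓝 (0:ℝ), bf ε + q ^ 2 < ω ^ (pf ε - 1) := by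
    refine ContinuousAt.eventually_lt (cbf.add continuousAt_const) cωp ?_
    simp only [hpf0, hbf0, hωpow, hq2]
    have : (ν + 1) / ν * b0 = b0 + b0 / (2 * ν) + b0 / (2 * ν) := by field_simp; ring
    rw [this]
    have : 0 < b0 / (2 * ν) := by positivity
    linarith
  have e3 : ∀ᶠ ε in 𝓝 (0:ℝ), bf ε + 1 < 2 * Ω ^ (pf ε - 1) / (pf ε + 1) := by
    refine ContinuousAt.eventually_lt (cbf.add continuousAt_const) ((cΩp.const_mul 2).div cpf1 hp0ne) ?_
    show bf 0 + 1 < 2 * Ω ^ (pf 0 - 1) / (pf 0 + 1)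
    simp only [hpf0, hbf0, hΩpow, hp01']
    have : 2 * ((ν + 2) / ν * (b0 + 2) + 1) / (2 * (ν + 2) / ν) = b0 + 2 + ν / (ν + 2) := by
      field_simp
    rw [this]
    have : 0 < ν / (ν + 2) := by positivity
    linarith
  have e4 : ∀ᶠ ε in 𝓝 (0:ℝ), bf ε < b0 + 1 :=
    cbf.eventually_lt continuousAt_const (by rw [hbf0]; linarith)
  have e5 : ∀ᶠ ε in 𝓝 (0:ℝ), 0 < bf ε :=
    continuousAt_const.eventually_lt cbf (by rw [hbf0]; exact hb0p)
  have csf : ContinuousAt (fun ε => 2 * af ε - ν) 0 := (caf.const_mul 2).sub continuousAt_const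
  have hsf0 : 2 * af 0 - ν = 0 := by rw [haf0]; ring
  have e6 : ∀ᶠ ε in 𝓝 (0:ℝ), 2 * af ε - ν < min 1 (min c q) :=
    csf.eventually_lt continuousAt_const (by
      rw [hsf0]; exact lt_min one_pos (lt_min hcp hqp))
  refine ⟨c, q, ω, Ω, b0 + 1, p0, ?_⟩
  filter_upwards [nhdsWithin_le_nhds e1, nhdsWithin_le_nhds e2, nhdsWithin_le_nhds e3,
    nhdsWithin_le_nhds e4, nhdsWithin_le_nhds e5, nhdsWithin_le_nhds e6, self_mem_nhdsWithin]
    with ε g1 g2 g3 g4 g5 g6 g7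
  have g7' : 0 < ε := g7
  rw [lt_min_iff, lt_min_iff] at g6
  exact ⟨hcp, hqp, hωp, hΩ1, g5, g4.le, by linarith, g6.1.le, g6.2.1.le, g6.2.2.le, g1.le, g2.le, g3.le⟩

/-- basic facts extracted from a radial solution -/
lemma radial_facts {n : ℕ} {p : ℝ} {u : ℝ → ℝ} (h : IsRadialSolution n p u) :
    ContinuousOn u (Icc 0 1) ∧ ContinuousOn (derivWithin u (Icc 0 1)) (Icc 0 1) ∧
    (∀ r ∈ Ioo (0:ℝ) 1, HasDerivAt u (deriv u r) r ∧ deriv u r = derivWithin u (Icc 0 1) r ∧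
      HasDerivAt (fun s => s ^ (n - 1) * deriv u s) (-(|u r| ^ (p - 1) * u r * r ^ (n - 1))) r) := by
  obtain ⟨h1, h2, h3⟩ := h
  refine ⟨h1.continuousOn, h1.continuousOn_derivWithin (uniqueDiffOn_Icc one_pos) (by norm_num), ?_⟩
  intro r hr
  have hnb : Icc (0:ℝ) 1 ∈ 𝓝 r := Icc_mem_nhds hr.1 hr.2
  have hcd : ContDiffAt ℝ 2 u r := h1.contDiffAt hnb
  have hdiff : DifferentiableAt ℝ u r := hcd.differentiableAt (by norm_num)
  refine ⟨hdiff.hasDerivAt, (derivWithin_of_mem_nhds hnb).symm, ?_⟩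
  have hdd : DifferentiableAt ℝ (deriv u) r := by
    have : ContDiffAt ℝ 1 (deriv u) r := hcd.derivWithin (by norm_num)
    exact this.differentiableAt (by norm_num)
  have : DifferentiableAt ℝ (fun s => s ^ (n - 1) * deriv u s) r :=
    (differentiableAt_id.pow _).mul hdd
  rw [← h3 r ⟨hr.1, hr.2.le⟩]
  exact this.hasDerivAt

lemma radial_EF {n : ℕ} (hn : 3 ≤ n) {p a σ b : ℝ} (hp : 1 < p) (ha : a = 2 / (p - 1))
    (hσ : σ = 2 * a - ((n:ℝ) - 2)) (hσ0 : 0 < σ) (hb : b = a * ((n:ℝ) - 2 - a))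
    {u : ℝ → ℝ} (h : IsRadialSolution n p u) :
    EF σ b p (fun t => exp (a * t) * u (exp t))
      (fun t => a * (exp (a * t) * u (exp t)) +
        exp ((a + 2 - n) * t) * ((exp t) ^ (n - 1) * deriv u (exp t)))
      (fun t => ∫ r in (0:ℝ)..(exp t), |u r| ^ (p + 1) * r ^ (n - 1)) := by
  obtain ⟨hc, hc', hd⟩ := radial_facts h
  have hp1 : 0 < p - 1 := by linarith
  have ha0 : 0 < a := by rw [ha]; positivity
  have hap : a * (p - 1) = 2 := by rw [ha]; field_simp
  have hmem : ∀ t < 0, exp t ∈ Ioo (0:ℝ) 1 := fun t ht => ⟨exp_pos t, by rwa [exp_lt_one_iff]⟩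
  have hexp : ∀ k t : ℝ, HasDerivAt (fun t => exp (k * t)) (exp (k * t) * k) t := fun k t => by
    have := ((hasDerivAt_id t).const_mul k).exp
    simpa using this
  have hpown : ∀ t, (exp t) ^ (n - 1) = exp (((n:ℝ) - 1) * t) := fun t => by
    rw [← Real.exp_nat_mul, Nat.cast_sub (by omega)]; simp
  have habs : ∀ t, |exp (a * t) * u (exp t)| = exp (a * t) * |u (exp t)| := fun t => by
    rw [abs_mul, abs_of_pos (exp_pos _)]
  have hpw : ∀ k t : ℝ, |exp (a * t) * u (exp t)| ^ k = exp (a * k * t) * |u (exp t)| ^ k := by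
    intro k t
    rw [habs, Real.mul_rpow (exp_pos _).le (abs_nonneg _), ← Real.exp_mul]
    ring_nf
  have hwd : ∀ t < 0, HasDerivAt (fun t => exp (a * t) * u (exp t)) (a * (exp (a * t) * u (exp t)) +
        exp ((a + 2 - n) * t) * ((exp t) ^ (n - 1) * deriv u (exp t))) t := by
    intro t ht
    have := (hexp a t).mul ((hd _ (hmem t ht)).1.comp t (Real.hasDerivAt_exp t))
    refine this.congr_deriv ?_
    have e : exp (a * t) * exp t = exp ((a + 2 - n) * t) * (exp t) ^ (n - 1) := by
      rw [hpown, ← exp_add, ← exp_add]; ring_nf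
    simp only [Function.comp_apply]
    linear_combination deriv u (exp t) * e
  have hcont : ContinuousOn (fun r => |u r| ^ (p + 1) * r ^ (n - 1)) (Icc 0 1) :=
    (hc.abs.rpow_const (fun x hx => Or.inr (by linarith))).mul (continuousOn_pow _)
  obtain ⟨C0, hC0⟩ := isCompact_Icc.exists_bound_of_continuousOn hc
  obtain ⟨C1, hC1⟩ := isCompact_Icc.exists_bound_of_continuousOn hc'
  obtain ⟨C2, hC2⟩ := isCompact_Icc.exists_bound_of_continuousOn hcont
  have hexplim : ∀ k : ℝ, 0 < k → Tendsto (fun t => exp (k * t)) atBot (𝓝 0) := fun k hk =>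
    Real.tendsto_exp_atBot.comp (tendsto_id.const_mul_atBot hk)
  have hsq : ∀ (k D : ℝ) (f : ℝ → ℝ), 0 < k → (∀ t < 0, |f t| ≤ D) →
      Tendsto (fun t => exp (k * t) * f t) atBot (𝓝 0) := by
    intro k D f hk hf
    refine squeeze_zero_norm' (a := fun t => exp (k * t) * D) ?_ (by simpa using (hexplim k hk).mul_const D)
    filter_upwards [eventually_lt_atBot 0] with t ht
    rw [norm_mul, Real.norm_eq_abs, Real.norm_eq_abs, abs_of_pos (exp_pos _)]
    gcongr
    exact hf t ht
  have hlimw : Tendsto (fun t => exp (a * t) * u (exp t)) atBot (𝓝 0) :=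
    hsq a C0 _ ha0 (fun t ht => hC0 _ (Ioo_subset_Icc_self (hmem t ht)))
  refine ⟨hσ0, hp, hwd, ?_, ?_, hlimw, ?_, ?_⟩
  · intro t ht
    have h1 := ((hwd t ht).const_mul a).add ((hexp (a + 2 - n) t).mul
      ((hd _ (hmem t ht)).2.2.comp t (Real.hasDerivAt_exp t)))
    refine h1.congr_deriv ?_
    have e : exp ((a + 2 - n) * t) * ((exp t) ^ (n - 1) * exp t) = exp (a * (p - 1) * t) * exp (a * t) := by
      rw [hpown, ← exp_add, ← exp_add, ← exp_add, hap]; ring_nf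
    rw [hpw (p - 1) t, hσ, hb]
    simp only [Function.comp_apply]
    linear_combination (-(|u (exp t)| ^ (p - 1) * u (exp t))) * e
  · intro t ht
    have hm := hmem t ht
    have hItg : IntervalIntegrable (fun r => |u r| ^ (p + 1) * r ^ (n - 1)) volume 0 (exp t) := by
      refine ContinuousOn.intervalIntegrable ?_
      rw [uIcc_of_le hm.1.le]
      exact hcont.mono (Icc_subset_Icc le_rfl hm.2.le)
    have h1 := intervalIntegral.integral_hasDerivAt_right hItg
      (hcont.mono Ioo_subset_Icc_self |>.stronglyMeasurableAtFilter isOpen_Ioo (exp t) hm)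
      (hcont.continuousAt (Icc_mem_nhds hm.1 hm.2))
    refine (h1.comp t (Real.hasDerivAt_exp t)).congr_deriv ?_
    rw [hpw (p + 1) t, hpown]
    have e : exp (((n:ℝ) - 1) * t) * exp t = exp (-σ * t) * exp (a * (p + 1) * t) := by
      rw [← exp_add, ← exp_add]
      congr 1
      rw [hσ]
      linear_combination (-t) * hap
    linear_combination |u (exp t)| ^ (p + 1) * e
  · have h2 : Tendsto (fun t => exp ((a + 1) * t) * deriv u (exp t)) atBot (𝓝 0) :=
      hsq (a + 1) C1 _ (by linarith) (fun t ht => by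
        rw [(hd _ (hmem t ht)).2.1]
        exact hC1 _ (Ioo_subset_Icc_self (hmem t ht)))
    have h3 := (hlimw.const_mul a).add h2
    simp only [mul_zero, add_zero] at h3
    refine h3.congr (fun t => ?_)
    congr 1
    rw [hpown, ← mul_assoc, ← exp_add]
    ring_nf
  · have h2 := hsq 1 C2 (fun t => exp (-t) * ∫ r in (0:ℝ)..(exp t), |u r| ^ (p + 1) * r ^ (n - 1)) one_pos
      (fun t ht => by
        have hm := hmem t ht
        have := intervalIntegral.norm_integral_le_of_norm_le_const (a := 0) (b := exp t) (C := C2)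
          (f := fun r => |u r| ^ (p + 1) * r ^ (n - 1)) (fun r hr => by
            rw [uIoc_of_le hm.1.le] at hr
            exact hC2 r ⟨hr.1.le, by linarith [hr.2, hm.2]⟩)
        rw [abs_mul, abs_of_pos (exp_pos _)]
        rw [Real.norm_eq_abs, sub_zero, abs_of_pos (exp_pos t)] at this
        calc _ ≤ exp (-t) * (C2 * exp t) := by gcongr
          _ = C2 := by rw [mul_comm C2, ← mul_assoc, ← exp_add]; simp)
    refine h2.congr (fun t => ?_)
    rw [← mul_assoc, ← exp_add]
    simp

lemma boundary_zero {n : ℕ} {p : ℝ} {u : ℝ → ℝ} (h : IsRadialSolution n p u) (h1 : deriv u 1 = 0) :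
    derivWithin u (Icc 0 1) 1 * u 1 = 0 := by
  by_cases hu : u 1 = 0
  · rw [hu, mul_zero]
  obtain ⟨hc, hc', hd⟩ := radial_facts h
  have h3 := h.2.2 1 ⟨one_pos, le_rfl⟩
  have hne : deriv (fun s => s ^ (n - 1) * deriv u s) 1 ≠ 0 := by
    rw [h3]
    have : 0 < |u 1| ^ (p - 1) := Real.rpow_pos_of_pos (abs_pos.mpr hu) _
    simp [this.ne', hu]
  have hcont := (differentiableAt_of_deriv_ne_zero hne).continuousAt
  have t1 : Tendsto (fun s : ℝ => s ^ (n - 1) * deriv u s) (𝓝[<] 1) (𝓝 0) := by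
    have := hcont.tendsto.mono_left (nhdsWithin_le_nhds (s := Iio 1))
    simpa [h1] using this
  have t2 : Tendsto (fun s : ℝ => s ^ (n - 1) * deriv u s) (𝓝[<] 1)
      (𝓝 (derivWithin u (Icc 0 1) 1)) := by
    have a1 : Tendsto (derivWithin u (Icc 0 1)) (𝓝[Ioo 0 1] 1) (𝓝 (derivWithin u (Icc 0 1) 1)) :=
      (hc' 1 (right_mem_Icc.mpr zero_le_one)).mono Ioo_subset_Icc_self
    rw [nhdsWithin_Ioo_eq_nhdsLT one_pos] at a1
    have a2 : Tendsto (fun s : ℝ => s ^ (n - 1)) (𝓝[<] 1) (𝓝 1) := by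
      have := ((continuous_pow (n - 1)).tendsto (1:ℝ)).mono_left (nhdsWithin_le_nhds (s := Iio 1))
      simpa using this
    have a3 := a2.mul a1
    rw [one_mul] at a3
    refine a3.congr' ?_
    filter_upwards [Ioo_mem_nhdsLT (one_pos : (0:ℝ) < 1)] with s hs
    rw [(hd s hs).2.1]
  rw [tendsto_nhds_unique t2 t1, zero_mul]

lemma grad_eq {n : ℕ} (hn : 3 ≤ n) {p : ℝ} (hp : 1 < p) {u : ℝ → ℝ} (h : IsRadialSolution n p u)
    (h1 : deriv u 1 = 0) :
    (∫ r in (0:ℝ)..1, deriv u r ^ 2 * r ^ (n - 1)) = ∫ r in (0:ℝ)..1, |u r| ^ (p + 1) * r ^ (n - 1) := by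
  obtain ⟨hc, hc', hd⟩ := radial_facts h
  set v := derivWithin u (Icc 0 1) with hv
  have hcont : ContinuousOn (fun r => |u r| ^ (p + 1) * r ^ (n - 1)) (Icc 0 1) :=
    (hc.abs.rpow_const (fun x hx => Or.inr (by linarith))).mul (continuousOn_pow _)
  have hcontv : ContinuousOn (fun r => v r ^ 2 * r ^ (n - 1)) (Icc 0 1) :=
    (hc'.pow 2).mul (continuousOn_pow _)
  have i1 : IntervalIntegrable (fun r => |u r| ^ (p + 1) * r ^ (n - 1)) volume 0 1 :=
    ContinuousOn.intervalIntegrable (by rwa [uIcc_of_le zero_le_one])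
  have i2 : IntervalIntegrable (fun r => v r ^ 2 * r ^ (n - 1)) volume 0 1 :=
    ContinuousOn.intervalIntegrable (by rwa [uIcc_of_le zero_le_one])
  have key := intervalIntegral.integral_eq_sub_of_hasDerivAt_of_le (zero_le_one' ℝ)
    (f := fun r => r ^ (n - 1) * v r * u r)
    (f' := fun r => v r ^ 2 * r ^ (n - 1) - |u r| ^ (p + 1) * r ^ (n - 1))
    (((continuousOn_pow _).mul hc').mul hc) (fun r hr => by
      obtain ⟨d1, d2, d3⟩ := hd r hr
      have d4 := d3.mul d1
      have heq : (fun r => r ^ (n - 1) * v r * u r) =ᶠ[𝓝 r] (fun s => s ^ (n - 1) * deriv u s * u s) := by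
        filter_upwards [Ioo_mem_nhds hr.1 hr.2] with s hs
        rw [(hd s hs).2.1]
      refine (d4.congr_of_eventuallyEq heq).congr_deriv ?_
      rw [abs_rpow_split _ _ hp, d2]
      ring) (i2.sub i1)
  rw [intervalIntegral.integral_sub i2 i1] at key
  have hb := boundary_zero h h1
  have hn1 : n - 1 ≠ 0 := by omega
  simp only [one_pow, one_mul, zero_pow hn1, zero_mul, sub_zero] at key
  rw [hb] at key
  have : (∫ r in (0:ℝ)..1, deriv u r ^ 2 * r ^ (n - 1)) = ∫ r in (0:ℝ)..1, v r ^ 2 * r ^ (n - 1) := by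
    refine intervalIntegral.integral_congr_Ioo_of_le zero_le_one (fun r hr => ?_)
    show deriv u r ^ 2 * r ^ (n - 1) = v r ^ 2 * r ^ (n - 1)
    rw [(hd r hr).2.1]
  linarith

/-- **Lemma 3.3 (energy bound).** For radial Neumann solutions with `m-1` interior
zeros, the `L^{2n/(n-2)-ε}` norm and the `L²` norm of the gradient (written as radial
integrals against `r^{n-1} dr`) are bounded uniformly for all small `ε > 0`. -/
theorem neumann_energy_bound (n m : ℕ) (hn : 3 ≤ n) (hm : 2 ≤ m)
    (u : ℝ → ℝ → ℝ)
    (hu : ∀ ε ∈ Set.Ioo (0 : ℝ) (4 / ((n : ℝ) - 2)),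
      NeumannSol n (pEps n ε) m (u ε)) :
    ∃ C : ℝ, 0 < C ∧ ∃ ε₀ ∈ Set.Ioo (0 : ℝ) (4 / ((n : ℝ) - 2)),
      ∀ ε ∈ Set.Ioo (0 : ℝ) ε₀,
        (∫ r in (0 : ℝ)..1, |u ε r| ^ (2 * (n : ℝ) / ((n : ℝ) - 2) - ε) * r ^ (n - 1)) +
          (∫ r in (0 : ℝ)..1, deriv (u ε) r ^ 2 * r ^ (n - 1)) < C := by
  have hν : (0:ℝ) < (n:ℝ) - 2 := by
    have : (3:ℝ) ≤ n := by exact_mod_cast hn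
    linarith
  obtain ⟨c, q, ω, Ω, B, P, hev⟩ := params ((n:ℝ) - 2) hν
  obtain ⟨C, hC⟩ := EF_main (m - 1) c q ω Ω B P
  obtain ⟨ε1, hε1, hsub⟩ := (mem_nhdsGT_iff_exists_Ioo_subset).mp hev
  have hε1' : (0:ℝ) < ε1 := hε1
  have h2ν : 0 < 2 / ((n:ℝ) - 2) := by positivity
  have h4ν : 4 / ((n:ℝ) - 2) = 2 * (2 / ((n:ℝ) - 2)) := by ring
  refine ⟨2 * |C| + 1, by positivity, min ε1 (2 / ((n:ℝ) - 2)), ⟨lt_min hε1' h2ν, ?_⟩, ?_⟩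
  · refine lt_of_le_of_lt (min_le_right _ _) ?_
    linarith
  intro ε hε
  have hε0 := hε.1
  have hεa : ε < ε1 := lt_of_lt_of_le hε.2 (min_le_left _ _)
  have hεb : ε < 4 / ((n:ℝ) - 2) := by
    have := lt_of_lt_of_le hε.2 (min_le_right _ _)
    linarith
  have k := hsub (show ε ∈ Ioo 0 ε1 from ⟨hε0, hεa⟩)
  obtain ⟨hrad, hder, -, Z, hZ, hZc⟩ := hu ε ⟨hε0, hεb⟩
  have hpe : ((n:ℝ) - 2 + 4) / ((n:ℝ) - 2) - ε = pEps n ε := by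
    unfold pEps; congr 2; ring
  have hpe1 : pEps n ε - 1 = 4 / ((n:ℝ) - 2) - ε := by
    unfold pEps; field_simp; ring
  have hpe2 : 2 * (n : ℝ) / ((n : ℝ) - 2) - ε = pEps n ε + 1 := by
    unfold pEps; field_simp; ring
  simp only [Set.mem_ofPred_eq, hpe] at k
  have hp : 1 < pEps n ε := by linarith
  set p := pEps n ε with hpdef
  have hp1 : 0 < p - 1 := by linarith
  have hσ0 : 0 < 2 * (2 / (p - 1)) - ((n:ℝ) - 2) := by
    have h5 : (p - 1) * ((n:ℝ) - 2) < 4 := by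
      have : 4 / ((n:ℝ) - 2) * ((n:ℝ) - 2) = 4 := by field_simp
      rw [hpe1]
      nlinarith
    have : (n:ℝ) - 2 < 4 / (p - 1) := by
      rw [lt_div_iff₀ hp1]; linarith
    have h6 : 2 * (2 / (p - 1)) = 4 / (p - 1) := by ring
    linarith
  have hEF := radial_EF hn hp rfl rfl hσ0 rfl hrad
  classical
  have hbound := hC _ _ _ _ _ _ (Z.image Real.log) hEF k
    (le_trans Finset.card_image_le hZc.le) (fun t ht h0 => by
      have h7 : u ε (exp t) = 0 := by
        rcases mul_eq_zero.mp h0 with h8 | h8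
        · exact absurd h8 (exp_pos _).ne'
        · exact h8
      have h8 : exp t ∈ (Z : Set ℝ) := by
        rw [hZ]
        exact ⟨⟨exp_pos t, by rwa [exp_lt_one_iff]⟩, h7⟩
      exact Finset.mem_image.mpr ⟨exp t, h8, Real.log_exp t⟩)
  obtain ⟨hc, -, -⟩ := radial_facts hrad
  have hcont : ContinuousOn (fun r => |u ε r| ^ (p + 1) * r ^ (n - 1)) (Icc 0 1) :=
    (hc.abs.rpow_const (fun x hx => Or.inr (by linarith))).mul (continuousOn_pow _)
  have hle : (∫ r in (0:ℝ)..1, |u ε r| ^ (p + 1) * r ^ (n - 1)) ≤ C := by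
    have i1 : IntegrableOn (fun r => |u ε r| ^ (p + 1) * r ^ (n - 1)) (uIcc 0 1) volume := by
      rw [uIcc_of_le zero_le_one]
      exact hcont.integrableOn_Icc
    have c1 := intervalIntegral.continuousOn_primitive_interval i1
    rw [uIcc_of_le zero_le_one] at c1
    have a1 := (c1 1 (right_mem_Icc.mpr zero_le_one)).mono Ioo_subset_Icc_self
    have a2 := a1.tendsto
    rw [nhdsWithin_Ioo_eq_nhdsLT one_pos] at a2
    refine le_of_tendsto a2 ?_
    have hlt : exp (-1) < 1 := by rw [exp_lt_one_iff]; norm_num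
    filter_upwards [Ioo_mem_nhdsLT hlt] with r hr
    have hr0 : 0 < r := lt_trans (exp_pos _) hr.1
    have := hbound (Real.log r) ((Real.lt_log_iff_exp_lt hr0).mpr hr.1) (Real.log_neg hr0 hr.2)
    simpa [Real.exp_log hr0] using this
  rw [hpe2, grad_eq hn hp hrad hder]
  linarith [le_abs_self C]
end
end

section
/- Let n ≥ 3, m ≥ 2, and for each ε ∈ (0, 4/(n−2)) let u_ε be a radial Neumann solution with exactly m−1 interior zeros, with largest interior zero ρ_{1,ε} (and largest critical point δ_{1,ε} = 1). Then, as ε → 0⁺: |u_ε(1)|^{4/(n−2)−ε} · ρ_{1,ε}^{2−n} → n(n−2) and |u_ε'(ρ_{1,ε})| · ρ_{1,ε}^{n−1} · |u_ε(1)|^{ε−(n+2)/(n−2)} → 1/n. -/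
open Real Set Filter Topology MeasureTheory

noncomputable section

/-- First-order form of the radial equation. -/
structure Rad (k : ℕ) (p : ℝ) (u u1 : ℝ → ℝ) : Prop where
  cu : ContinuousOn u (Icc 0 1)
  cu1 : ContinuousOn u1 (Icc 0 1)
  d1 : ∀ r ∈ Ioo (0:ℝ) 1, HasDerivAt u (u1 r) r
  d2 : ∀ r ∈ Ioo (0:ℝ) 1, HasDerivAt u1 (-(((k:ℝ)+2)/r * u1 r) - |u r| ^ (p-1) * u r) r

lemma Rad.neg {k : ℕ} {p : ℝ} {u u1 : ℝ → ℝ} (h : Rad k p u u1) :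
    Rad k p (fun r => - u r) (fun r => - u1 r) where
  cu := h.cu.neg
  cu1 := h.cu1.neg
  d1 := fun r hr => (h.d1 r hr).neg
  d2 := fun r hr => by
    have := (h.d2 r hr).neg
    refine this.congr_deriv ?_
    rw [abs_neg]; ring

lemma rad_of {k : ℕ} {p : ℝ} {u : ℝ → ℝ} (h : IsRadialSolution (k+3) p u) :
    Rad k p u (derivWithin u (Icc 0 1)) := by
  obtain ⟨hc, -, he⟩ := h
  have hud : UniqueDiffOn ℝ (Icc (0:ℝ) 1) := uniqueDiffOn_Icc one_pos
  have h1 : ContDiffOn ℝ 1 (derivWithin u (Icc 0 1)) (Icc 0 1) :=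
    hc.derivWithin hud (by norm_num)
  have hd1 : ∀ r ∈ Ioo (0:ℝ) 1, HasDerivAt u (derivWithin u (Icc 0 1) r) r := by
    intro r hr
    have hmem : Icc (0:ℝ) 1 ∈ 𝓝 r := Icc_mem_nhds hr.1 hr.2
    exact ((hc.differentiableOn (by norm_num) r (Ioo_subset_Icc_self hr)).hasDerivWithinAt).hasDerivAt hmem
  refine ⟨hc.continuousOn, h1.continuousOn, hd1, ?_⟩
  intro r hr
  have hmem : Icc (0:ℝ) 1 ∈ 𝓝 r := Icc_mem_nhds hr.1 hr.2
  obtain ⟨w, hw⟩ : ∃ w, HasDerivAt (derivWithin u (Icc 0 1)) w r :=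
    ⟨_, ((h1.differentiableOn (by norm_num) r (Ioo_subset_Icc_self hr)).hasDerivWithinAt).hasDerivAt hmem⟩
  have h2 := he r ⟨hr.1, hr.2.le⟩
  have h3 : HasDerivAt (fun s => s ^ (k+3-1) * deriv u s)
      (((k+2 : ℕ):ℝ) * r ^ (k+1) * derivWithin u (Icc 0 1) r + r^(k+2) * w) r := by
    have := (hasDerivAt_pow (k+2) r).mul hw
    refine this.congr_of_eventuallyEq ?_
    filter_upwards [Ioo_mem_nhds hr.1 hr.2] with s hs
    simp [(hd1 s hs).deriv]
  rw [h3.deriv] at h2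
  refine hw.congr_deriv ?_
  have hr0 : r ≠ 0 := hr.1.ne'
  have : r^(k+2) * w = r^(k+2) * (-(((k:ℝ)+2)/r * derivWithin u (Icc 0 1) r) - |u r| ^ (p-1) * u r) := by
    have e : r^(k+2) * (-(((k:ℝ)+2)/r * derivWithin u (Icc 0 1) r) - |u r| ^ (p-1) * u r)
       = -(((k:ℝ)+2) * r^(k+1) * derivWithin u (Icc 0 1) r) - r^(k+2) * (|u r| ^ (p-1) * u r) := by
      field_simp
      ring
    rw [e]
    push_cast at h2
    have h2 : ((k:ℝ)+2) * r ^ (k+1) * derivWithin u (Icc 0 1) r + r^(k+2) * w =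
      -(|u r| ^ (p - 1) * u r * r ^ (k+2)) := h2
    linarith
  exact mul_left_cancel₀ (pow_ne_zero _ hr0) this

/-- Value of the one-sided derivative at `1`. -/
lemma rad_neumann {k : ℕ} {p : ℝ} {u : ℝ → ℝ} (h : IsRadialSolution (k+3) p u)
    (hd : deriv u 1 = 0) (h1 : u 1 ≠ 0) : derivWithin u (Icc 0 1) 1 = 0 := by
  have hR := rad_of h
  have he := h.2.2 1 ⟨one_pos, le_rfl⟩
  have hne : deriv (fun s => s ^ (k+3-1) * deriv u s) 1 ≠ 0 := by
    rw [he]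
    have : 0 < |u 1| ^ (p-1) := Real.rpow_pos_of_pos (abs_pos.2 h1) _
    simp [this.ne', h1]
  have hc := (differentiableAt_of_deriv_ne_zero hne).continuousAt
  have t1 : Tendsto (fun s => s ^ (k+3-1) * deriv u s) (𝓝[<] 1) (𝓝 0) := by
    have := hc.tendsto.mono_left (nhdsWithin_le_nhds (s := Iio (1:ℝ)))
    simpa [hd] using this
  have t2 : Tendsto (fun s => s ^ (k+2) * derivWithin u (Icc 0 1) s) (𝓝[<] 1)
      (𝓝 (derivWithin u (Icc 0 1) 1)) := by
    have hca : ContinuousOn (fun s => s ^ (k+2) * derivWithin u (Icc 0 1) s) (Icc 0 1) :=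
      (continuousOn_pow _).mul hR.cu1
    have := (hca 1 ⟨zero_le_one, le_rfl⟩).mono_left
      (nhdsWithin_mono _ (Ioo_subset_Icc_self (a := (0:ℝ)) (b := 1)))
    rw [nhdsWithin_Ioo_eq_nhdsLT one_pos] at this
    simpa using this
  refine tendsto_nhds_unique t2 (t1.congr' ?_)
  filter_upwards [Ioo_mem_nhdsLT one_pos] with s hs
  simp [(hR.d1 s hs).deriv]

/-- Energy (Pohozaev) in Emden-Fowler variables. -/
def En (p b Y Z : ℝ) : ℝ := Z^2/2 - b * Y^2/2 + |Y|^(p+1)/(p+1)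

/-- At a zero-velocity point with nonnegative energy, the acceleration is negative. -/
lemma acc_neg {p b Y : ℝ} (hp : 1 < p) (hb : 0 < b) (hY : 0 < Y) (hE : 0 ≤ En p b Y 0) :
    b * Y - |Y|^(p-1) * Y < 0 := by
  unfold En at hE
  rw [abs_of_pos hY] at *
  have e : Y^(p+1) = Y^(p-1) * Y^2 := by
    rw [← Real.rpow_natCast, ← Real.rpow_add hY]; congr 1; push_cast; ring
  rw [e] at hE
  set q := Y^(p-1)
  have h1 : 0 ≤ Y^2 * (q/(p+1) - b/2) := by
    have : Y^2 * (q/(p+1) - b/2) = (0:ℝ)^2/2 - b * Y^2/2 + q*Y^2/(p+1) := by ring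
    linarith
  have h2 : 0 ≤ q/(p+1) - b/2 := nonneg_of_mul_nonneg_right h1 (by positivity)
  have h3 : b/2 * (p+1) ≤ q := by
    rw [← le_div_iff₀ (by linarith)]; linarith
  have : b < q := by nlinarith
  nlinarith

/-- First-order Emden-Fowler system on `(α, β)`. -/
structure EF_s15 (p b c α β : ℝ) (y z : ℝ → ℝ) : Prop where
  cy : ContinuousOn y (Icc α β)
  cz : ContinuousOn z (Icc α β)
  dy : ∀ r ∈ Ioo α β, HasDerivAt y (z r / r) r
  dz : ∀ r ∈ Ioo α β, HasDerivAt z ((c * z r + b * y r - |y r|^(p-1) * y r)/r) r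

lemma EF_s15.mono {p b c α β α' β' : ℝ} {y z : ℝ → ℝ} (h : EF_s15 p b c α β y z) (h1 : α ≤ α')
    (h2 : β' ≤ β) : EF_s15 p b c α' β' y z where
  cy := h.cy.mono (Icc_subset_Icc h1 h2)
  cz := h.cz.mono (Icc_subset_Icc h1 h2)
  dy := fun r hr => h.dy r (Ioo_subset_Ioo h1 h2 hr)
  dz := fun r hr => h.dz r (Ioo_subset_Ioo h1 h2 hr)

lemma EF_s15.neg {p b c α β : ℝ} {y z : ℝ → ℝ} (h : EF_s15 p b c α β y z) :
    EF_s15 p b c α β (fun r => - y r) (fun r => - z r) where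
  cy := h.cy.neg
  cz := h.cz.neg
  dy := fun r hr => (h.dy r hr).neg.congr_deriv (by ring)
  dz := fun r hr => (h.dz r hr).neg.congr_deriv (by rw [abs_neg]; ring)

lemma EF_s15.cE {p b c α β : ℝ} {y z : ℝ → ℝ} (h : EF_s15 p b c α β y z) (hp : 1 < p) :
    ContinuousOn (fun r => En p b (y r) (z r)) (Icc α β) := by
  unfold En
  have := (h.cy.abs).rpow_const (p := p+1) (fun x _ => Or.inr (by linarith))
  have hy := h.cy
  have hz := h.cz
  fun_prop

lemma EF_s15.dE {p b c α β : ℝ} {y z : ℝ → ℝ} (h : EF_s15 p b c α β y z) (hp : 1 < p) 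
    {r : ℝ} (hr : r ∈ Ioo α β) (hy : 0 < y r) :
    HasDerivAt (fun r => En p b (y r) (z r)) (c * z r^2 / r) r := by
  unfold En
  have h1 := h.dy r hr
  have h2 := h.dz r hr
  have h3 : HasDerivAt (fun r => |y r|^(p+1)) (z r / r * (p+1) * (y r)^(p+1-1)) r := by
    have := h1.rpow_const (p := p+1) (Or.inl hy.ne')
    refine this.congr_of_eventuallyEq ?_
    filter_upwards [h1.continuousAt.eventually (lt_mem_nhds hy)] with s hs
    rw [abs_of_pos hs]
  have h4 := (((h2.pow 2).div_const 2).sub (((h1.pow 2).const_mul b).div_const 2)).add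
    (h3.div_const (p+1))
  refine h4.congr_deriv ?_
  have e : (y r)^(p+1-1) = (y r)^(p-1) * y r := by
    rw [show p+1-1 = (p-1)+1 by ring, Real.rpow_add_one hy.ne']
  rw [e, abs_of_pos hy]
  have : p + 1 ≠ 0 := by linarith
  field_simp
  push_cast
  ring

lemma EF_s15.mE {p b c α β : ℝ} {y z : ℝ → ℝ} (h : EF_s15 p b c α β y z) (hp : 1 < p) (hc : 0 ≤ c)
    (hα : 0 ≤ α) (hy : ∀ r ∈ Ioo α β, 0 < y r) :
    MonotoneOn (fun r => En p b (y r) (z r)) (Icc α β) := by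
  refine monotoneOn_of_hasDerivWithinAt_nonneg (f' := fun r => c * z r^2 / r) (convex_Icc _ _) (h.cE hp) ?_ ?_
  · intro r hr
    rw [interior_Icc] at hr
    exact (h.dE hp hr (hy r hr)).hasDerivWithinAt
  · intro r hr
    rw [interior_Icc] at hr
    have : 0 < r := hα.trans_lt hr.1
    positivity

/-- Right after a critical point with negative acceleration, a function is strictly below. -/
lemma not_min_of {y z : ℝ → ℝ} {r x w : ℝ} (hx : 0 < r) (hrx : r < x)
    (hy : ∀ s ∈ Ico r x, HasDerivAt y (z s / s) s) (hz : HasDerivAt z w r)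
    (h0 : z r = 0) (hw : w < 0) (hmin : ∀ s ∈ Icc r x, y r ≤ y s) : False := by
  have h1 : ∀ᶠ s in 𝓝[>] r, z s < 0 := by
    have := hz.tendsto_slope
    have h2 : ∀ᶠ s in 𝓝[≠] r, slope z r s < 0 := this.eventually (gt_mem_nhds hw)
    have h3 := h2.filter_mono (nhdsWithin_mono r (fun s (hs : r < s) => hs.ne'))
    filter_upwards [h3, self_mem_nhdsWithin] with s hs hs'
    have hs' : r < s := hs'
    rw [slope_def_field, h0] at hs
    by_contra hcon
    push Not at hcon
    have : 0 ≤ (z s - 0)/(s - r) := div_nonneg (by linarith) (by linarith)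
    linarith
  obtain ⟨v, hv, hv'⟩ := (mem_nhdsGT_iff_exists_Ioo_subset' hrx).1 h1
  have hv : r < v := hv
  set v' := min v ((r+x)/2) 
  have hv1 : r < v' := lt_min hv (by linarith)
  have hv2 : v' ≤ v := min_le_left _ _
  have hv3 : v' < x := (min_le_right _ _).trans_lt (by linarith)
  have ha : StrictAntiOn y (Icc r v') := by
    refine strictAntiOn_of_hasDerivWithinAt_neg (f' := fun s => z s / s) (convex_Icc _ _) ?_ ?_ ?_
    · intro s hs
      exact (hy s ⟨hs.1, hs.2.trans_lt hv3⟩).continuousAt.continuousWithinAt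
    · intro s hs
      rw [interior_Icc] at hs
      exact (hy s ⟨hs.1.le, hs.2.trans hv3⟩).hasDerivWithinAt
    · intro s hs
      rw [interior_Icc] at hs
      exact div_neg_of_neg_of_pos (hv' ⟨hs.1, hs.2.trans_le hv2⟩) (hx.trans hs.1)
  have := ha (left_mem_Icc.2 hv1.le) (right_mem_Icc.2 hv1.le) hv1
  have := hmin v' ⟨hv1.le, hv3.le⟩
  linarith

lemma deriv_nonneg_right {f : ℝ → ℝ} {f' t x : ℝ} (hd : HasDerivAt f f' t) (hx : t < x)
    (h : ∀ s ∈ Icc t x, f t ≤ f s) : 0 ≤ f' := by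
  have h1 := hd.tendsto_slope.mono_left (nhdsWithin_mono t (s := Ioi t) (fun s (hs : t < s) => hs.ne'))
  refine ge_of_tendsto h1 ?_
  filter_upwards [Ioo_mem_nhdsGT hx] with s hs
  rw [slope_def_field]
  exact div_nonneg (by linarith [h s ⟨hs.1.le, hs.2.le⟩]) (by linarith [hs.1])

lemma deriv_nonpos_left {f : ℝ → ℝ} {f' t x : ℝ} (hd : HasDerivAt f f' t) (hx : x < t)
    (h : ∀ s ∈ Icc x t, f t ≤ f s) : f' ≤ 0 := by
  have h1 := hd.tendsto_slope.mono_left (nhdsWithin_mono t (s := Iio t) (fun s (hs : s < t) => hs.ne))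
  refine le_of_tendsto h1 ?_
  filter_upwards [Ioo_mem_nhdsLT hx] with s hs
  rw [slope_def_field]
  exact div_nonpos_of_nonneg_of_nonpos (by linarith [h s ⟨hs.1.le, hs.2.le⟩]) (by linarith [hs.2])

/-- No interior minimum. -/
lemma EF_s15.no_min {p b c α β : ℝ} {y z : ℝ → ℝ} (h : EF_s15 p b c α β y z) (hp : 1 < p) (hb : 0 < b)
    (hc : 0 ≤ c) (hα : 0 ≤ α) (hy : ∀ r ∈ Ioo α β, 0 < y r) (hE : 0 ≤ En p b (y α) (z α))
    {s t x : ℝ} (hs : α ≤ s) (ht : t ≤ β) (hx : x ∈ Ioo s t)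
    (hmin : ∀ r ∈ Icc s t, y x ≤ y r) : False := by
  have hxI : x ∈ Ioo α β := ⟨hs.trans_lt hx.1, hx.2.trans_le ht⟩
  have hx0 : 0 < x := hα.trans_lt hxI.1
  have hlm : IsLocalMin y x := by
    filter_upwards [Ioo_mem_nhds hx.1 hx.2] with r hr
    exact hmin r (Ioo_subset_Icc_self hr)
  have hz := hlm.hasDerivAt_eq_zero (h.dy x hxI)
  have hz : z x = 0 := by
    rcases div_eq_zero_iff.1 hz with h | h
    · exact h
    · exact absurd h hx0.ne'
  have hEx : 0 ≤ En p b (y x) 0 := by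
    have := (h.mE hp hc hα hy) (left_mem_Icc.2 (hxI.1.trans hxI.2).le) (Ioo_subset_Icc_self hxI) hxI.1.le
    simp only [hz] at this
    linarith
  have hacc := acc_neg hp hb (hy x hxI) hEx
  refine not_min_of hx0 hx.2 (fun r hr => h.dy r ⟨hxI.1.trans_le hr.1, hr.2.trans_le ht⟩)
    (h.dz x hxI) hz ?_ (fun r hr => hmin r ⟨hx.1.le.trans hr.1, hr.2⟩)
  rw [hz]
  exact div_neg_of_neg_of_pos (by linarith) hx0

lemma EF_s15.hump_pre {p b c α β M : ℝ} {y z : ℝ → ℝ} (h : EF_s15 p b c α β y z) (hp : 1 < p) (hb : 0 < b)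
    (hc : 0 ≤ c) (hα : 0 ≤ α) (hαβ : α < β) (hy : ∀ r ∈ Ioo α β, 0 < y r)
    (hE : 0 ≤ En p b (y α) (z α))
    (hM : ∀ r ∈ Icc α β, |y r| ≤ M ∧ |z r| ≤ M) :
    En p b (y β) (z β) ≤ En p b (y α) (z α) + 4 * c * M^2 := by
  obtain ⟨μ, hμ, hmax⟩ := isCompact_Icc.exists_isMaxOn (nonempty_Icc.2 hαβ.le) h.cy
  have hmax : ∀ s ∈ Icc α β, y s ≤ y μ := fun s hs => hmax hs
  have hM0 : 0 ≤ M := (abs_nonneg _).trans (hM α (left_mem_Icc.2 hαβ.le)).1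
  have hl : ∀ t ∈ Ioo α μ, 0 ≤ z t := by
    intro t ht
    by_contra hneg
    push Not at hneg
    have htI : t ∈ Ioo α β := ⟨ht.1, ht.2.trans_le hμ.2⟩
    have ht0 : 0 < t := hα.trans_lt ht.1
    have hneg' : z t / t < 0 := div_neg_of_neg_of_pos hneg ht0
    obtain ⟨x, hx, hmin⟩ := isCompact_Icc.exists_isMinOn (nonempty_Icc.2 ht.2.le)
      (h.cy.mono (Icc_subset_Icc ht.1.le hμ.2))
    have hmin : ∀ s ∈ Icc t μ, y x ≤ y s := fun s hs => hmin hs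
    have hne : ¬ (∀ s ∈ Icc t μ, y t ≤ y s) := fun hcon =>
      absurd (deriv_nonneg_right (h.dy t htI) ht.2 hcon) (not_le.2 hneg')
    have hxt : t ≠ x := by rintro rfl; exact hne hmin
    have hxμ : x ≠ μ := by
      rintro rfl
      exact hne (fun s hs => (hmax t (Ioo_subset_Icc_self htI)).trans (hmin s hs))
    exact h.no_min hp hb hc hα hy hE ht.1.le hμ.2 ⟨lt_of_le_of_ne hx.1 hxt, lt_of_le_of_ne hx.2 hxμ⟩ hmin
  have hr : ∀ t ∈ Ioo μ β, z t ≤ 0 := by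
    intro t ht
    by_contra hneg
    push Not at hneg
    have htI : t ∈ Ioo α β := ⟨hμ.1.trans_lt ht.1, ht.2⟩
    have ht0 : 0 < t := hα.trans_lt htI.1
    have hneg' : 0 < z t / t := div_pos hneg ht0
    obtain ⟨x, hx, hmin⟩ := isCompact_Icc.exists_isMinOn (nonempty_Icc.2 ht.1.le)
      (h.cy.mono (Icc_subset_Icc hμ.1 ht.2.le))
    have hmin : ∀ s ∈ Icc μ t, y x ≤ y s := fun s hs => hmin hs
    have hne : ¬ (∀ s ∈ Icc μ t, y t ≤ y s) := fun hcon =>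
      absurd (deriv_nonpos_left (h.dy t htI) ht.1 hcon) (not_le.2 hneg')
    have hxt : x ≠ t := by rintro rfl; exact hne hmin
    have hxμ : μ ≠ x := by
      rintro rfl
      exact hne (fun s hs => (hmax t (Ioo_subset_Icc_self htI)).trans (hmin s hs))
    exact h.no_min hp hb hc hα hy hE hμ.1 ht.2.le ⟨lt_of_le_of_ne hx.1 hxμ, lt_of_le_of_ne hx.2 hxt⟩ hmin
  have key : ∀ (σ : ℝ) (s t : ℝ), α ≤ s → s ≤ t → t ≤ β → |σ| ≤ 1 →
      (∀ r ∈ Ioo s t, σ * z r = |z r|) →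
      En p b (y t) (z t) ≤ En p b (y s) (z s) + 2 * c * M^2 := by
    intro σ s t hs hst ht hσ hsig
    have hsub : Icc s t ⊆ Icc α β := Icc_subset_Icc hs ht
    have ha : AntitoneOn (fun r => En p b (y r) (z r) - c * M * (σ * y r)) (Icc s t) := by
      refine antitoneOn_of_hasDerivWithinAt_nonpos
        (f' := fun r => c * z r^2 / r - c * M * (σ * (z r / r))) (convex_Icc _ _) ?_ ?_ ?_
      · exact ((h.cE hp).mono hsub).sub (((h.cy.mono hsub).const_smul σ).const_smul (c*M))
      · intro r hr
        rw [interior_Icc] at hr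
        have hrI : r ∈ Ioo α β := ⟨hs.trans_lt hr.1, hr.2.trans_le ht⟩
        exact ((h.dE hp hrI (hy r hrI)).sub (((h.dy r hrI).const_mul σ).const_mul (c*M))).hasDerivWithinAt
      · intro r hr
        rw [interior_Icc] at hr
        have hrI : r ∈ Ioo α β := ⟨hs.trans_lt hr.1, hr.2.trans_le ht⟩
        have hr0 : 0 < r := hα.trans_lt hrI.1
        have e : c * z r^2 / r - c * M * (σ * (z r / r)) = c * (|z r| * (|z r| - M)) / r := by
          rw [← sq_abs (z r)]
          have := hsig r hr
          have e2 : σ * (z r / r) = |z r| / r := by rw [← this]; ring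
          rw [e2]; ring
        rw [e]
        have := (hM r (Ioo_subset_Icc_self hrI)).2
        refine div_nonpos_of_nonpos_of_nonneg ?_ hr0.le
        refine mul_nonpos_of_nonneg_of_nonpos hc (mul_nonpos_of_nonneg_of_nonpos (abs_nonneg _) (by linarith))
    have h1 := ha (left_mem_Icc.2 hst) (right_mem_Icc.2 hst) hst
    simp only at h1
    have b1 : ∀ r ∈ Icc α β, |σ * y r| ≤ M := by
      intro r hr
      rw [abs_mul]
      calc |σ| * |y r| ≤ 1 * M := mul_le_mul hσ (hM r hr).1 (abs_nonneg _) zero_le_one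
        _ = M := one_mul M
    have b2 := abs_le.1 (b1 s (hsub (left_mem_Icc.2 hst)))
    have b3 := abs_le.1 (b1 t (hsub (right_mem_Icc.2 hst)))
    have : c * M * (σ * y t - σ * y s) ≤ c * M * (2*M) :=
      mul_le_mul_of_nonneg_left (by linarith) (by positivity)
    nlinarith
  have k1 := key 1 α μ le_rfl hμ.1 hμ.2 (by simp) (fun r hr => by rw [one_mul, abs_of_nonneg (hl r hr)])
  have k2 := key (-1) μ β hμ.1 hμ.2 le_rfl (by simp) (fun t ht => by rw [abs_of_nonpos (hr t ht)]; ring)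
  linarith

/-- Energy increment over one nodal interval. -/
lemma EF_s15.hump_pos {p b c α β M : ℝ} {y z : ℝ → ℝ} (h : EF_s15 p b c α β y z) (hp : 1 < p) (hb : 0 < b)
    (hc : 0 ≤ c) (hα : 0 ≤ α) (hαβ : α < β) (hy : ∀ r ∈ Ioo α β, 0 < y r)
    (hE : 0 ≤ En p b (y α) (z α))
    (hM : ∀ Y Z, En p b Y Z ≤ 1 → |Y| ≤ M ∧ |Z| ≤ M)
    (hlt : En p b (y α) (z α) + 4 * c * M^2 < 1) :
    0 ≤ En p b (y β) (z β) ∧ En p b (y β) (z β) ≤ En p b (y α) (z α) + 4 * c * M^2 := by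
  have hm := h.mE hp hc hα hy
  have hcm : 0 ≤ 4 * c * M^2 := by positivity
  refine ⟨hE.trans (hm (left_mem_Icc.2 hαβ.le) (right_mem_Icc.2 hαβ.le) hαβ.le), ?_⟩
  have main : ∀ γ ∈ Ioc α β, En p b (y γ) (z γ) ≤ 1 →
      En p b (y γ) (z γ) ≤ En p b (y α) (z α) + 4 * c * M^2 := by
    intro γ hγ h1
    refine (h.mono le_rfl hγ.2).hump_pre hp hb hc hα hγ.1 (fun r hr => hy r ⟨hr.1, hr.2.trans_le hγ.2⟩) hE ?_
    intro r hr
    exact hM _ _ ((hm ⟨hr.1, hr.2.trans hγ.2⟩ ⟨hγ.1.le, hγ.2⟩ hr.2).trans h1)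
  rcases le_or_gt (En p b (y β) (z β)) 1 with h1 | h1
  · exact main β ⟨hαβ, le_rfl⟩ h1
  · exfalso
    obtain ⟨γ, hγ, hγ1⟩ := intermediate_value_Icc hαβ.le (h.cE hp)
      (show (1:ℝ) ∈ Icc _ _ from ⟨by linarith, h1.le⟩)
    simp only at hγ1
    have : α ≠ γ := by rintro rfl; linarith
    have := main γ ⟨lt_of_le_of_ne hγ.1 this, hγ.2⟩ hγ1.le
    linarith

lemma En_neg (p b Y Z : ℝ) : En p b (-Y) (-Z) = En p b Y Z := by
  unfold En; rw [abs_neg]; ring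

lemma EF_s15.hump {p b c α β M : ℝ} {y z : ℝ → ℝ} (h : EF_s15 p b c α β y z) (hp : 1 < p) (hb : 0 < b)
    (hc : 0 ≤ c) (hα : 0 ≤ α) (hαβ : α < β) (hy : ∀ r ∈ Ioo α β, y r ≠ 0)
    (hE : 0 ≤ En p b (y α) (z α))
    (hM : ∀ Y Z, En p b Y Z ≤ 1 → |Y| ≤ M ∧ |Z| ≤ M)
    (hlt : En p b (y α) (z α) + 4 * c * M^2 < 1) :
    0 ≤ En p b (y β) (z β) ∧ En p b (y β) (z β) ≤ En p b (y α) (z α) + 4 * c * M^2 := by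
  have hcy : ContinuousOn y (Ioo α β) := h.cy.mono Ioo_subset_Icc_self
  have hoc : OrdConnected (Ioo α β) := ordConnected_Ioo
  by_cases hs : ∃ r ∈ Ioo α β, 0 < y r
  · obtain ⟨r, hr, hr0⟩ := hs
    refine h.hump_pos hp hb hc hα hαβ (fun s hs => ?_) hE hM hlt
    by_contra hcon
    push Not at hcon
    obtain ⟨x, hx, hx0⟩ := (isPreconnected_Ioo.image y hcy).ordConnected.out
      (mem_image_of_mem y hs) (mem_image_of_mem y hr) (show (0:ℝ) ∈ Icc (y s) (y r) from ⟨hcon, hr0.le⟩)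
    exact hy x hx hx0
  · push Not at hs
    have := h.neg.hump_pos hp hb hc hα hαβ (fun s hs' => ?_) (by rw [En_neg]; exact hE) hM
      (by rw [En_neg]; exact hlt)
    · simpa only [En_neg] using this
    · have := lt_of_le_of_ne (hs s hs') (hy s hs')
      show 0 < - y s
      linarith

lemma ef_of_rad {k : ℕ} {p a : ℝ} {u u1 : ℝ → ℝ} (h : Rad k p u u1) (hp : 1 < p)
    (ha : a = 2/(p-1)) :
    EF_s15 p (a*((k:ℝ)+1-a)) (2*a-((k:ℝ)+1)) 0 1 (fun r => r^a * u r)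
      (fun r => r^a * (r * u1 r + a * u r)) := by
  have ha0 : 0 < a := by rw [ha]; exact div_pos two_pos (by linarith)
  have hca : ContinuousOn (fun r : ℝ => r^a) (Icc 0 1) :=
    (Real.continuous_rpow_const ha0.le).continuousOn
  have hu := h.cu
  have hu1 := h.cu1
  refine ⟨by fun_prop, by fun_prop, ?_, ?_⟩
  · intro r hr
    have hr0 : r ≠ 0 := hr.1.ne'
    have h1 := (Real.hasDerivAt_rpow_const (p := a) (Or.inl hr0)).mul (h.d1 r hr)
    refine h1.congr_deriv ?_
    rw [Real.rpow_sub_one hr0]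
    field_simp
    ring
  · intro r hr
    have hr0 : r ≠ 0 := hr.1.ne'
    have h1 := (Real.hasDerivAt_rpow_const (p := a) (Or.inl hr0)).mul
      (((hasDerivAt_id r).mul (h.d2 r hr)).add ((h.d1 r hr).const_mul a))
    simp only [id] at h1
    refine h1.congr_deriv ?_
    have e : |r^a * u r|^(p-1) = r^2 * |u r|^(p-1) := by
      rw [abs_mul, Real.mul_rpow (abs_nonneg _) (abs_nonneg _),
        abs_of_pos (Real.rpow_pos_of_pos hr.1 a), ← Real.rpow_mul hr.1.le, ha,
        div_mul_cancel₀ _ (by linarith : p - 1 ≠ 0)]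
      norm_num
    rw [e, Real.rpow_sub_one hr0]
    simp only [Pi.add_apply, Pi.mul_apply, id]
    field_simp
    ring

lemma En_bound (B q P : ℝ) (hB : 0 ≤ B) (hq : 0 < q) (hP : 0 ≤ P) :
    ∃ M : ℝ, ∀ p b : ℝ, q ≤ p - 1 → p ≤ P → b ≤ B →
      ∀ Y Z, En p b Y Z ≤ 1 → |Y| ≤ M ∧ |Z| ≤ M := by
  set K := (P+1)*(1+B/2) with hK
  have hK1 : 1 ≤ K := by nlinarith
  set M1 := K^(1/q)
  have hM1 : 1 ≤ M1 := Real.one_le_rpow hK1 (by positivity)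
  refine ⟨M1 + (2 + B * M1^2), ?_⟩
  intro p b hp hpP hbB Y Z hE
  unfold En at hE
  have hp1 : 0 < p + 1 := by linarith
  have hY : |Y| ≤ M1 := by
    by_contra hcon
    push Not at hcon
    have hY1 : 1 ≤ |Y| := by linarith
    have hY0 : 0 < |Y| := by linarith
    have e : |Y|^(p+1) = |Y|^(p-1) * |Y|^2 := by
      rw [← Real.rpow_natCast, ← Real.rpow_add hY0]; congr 1; push_cast; ring
    rw [e, ← sq_abs Y] at hE
    have h1 : |Y|^(p-1) * |Y|^2/(p+1) ≤ (1 + B/2) * |Y|^2 := by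
      have : b * |Y|^2 ≤ B * |Y|^2 := mul_le_mul_of_nonneg_right hbB (by positivity)
      nlinarith [sq_nonneg Z]
    rw [div_le_iff₀ hp1] at h1
    have h2 : |Y|^(p-1) ≤ (1+B/2)*(p+1) := by
      refine le_of_mul_le_mul_right (a := |Y|^2) ?_ (by positivity)
      linarith
    have h3 : |Y|^(p-1) ≤ K := h2.trans (by rw [hK]; nlinarith)
    have h4 : |Y|^q ≤ |Y|^(p-1) := Real.rpow_le_rpow_of_exponent_le hY1 hp
    have h5 : M1^q < |Y|^q := Real.rpow_lt_rpow (by linarith) hcon hq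
    have h6 : M1^q = K := by
      rw [← Real.rpow_mul (by linarith)]; field_simp; simp
    linarith
  have hZ : |Z| ≤ 2 + B*M1^2 := by
    have h0 : 0 ≤ |Y|^(p+1)/(p+1) := by positivity
    have hYY : Y^2 ≤ M1^2 := by rw [← sq_abs]; gcongr
    have h1 : b * Y^2 ≤ B * M1^2 := 
      (mul_le_mul_of_nonneg_right hbB (sq_nonneg _)).trans (mul_le_mul_of_nonneg_left hYY hB)
    have h2 : |Z|^2 ≤ 2 + B*M1^2 := by rw [sq_abs]; linarith
    by_contra hcon
    push Not at hcon
    have : 0 ≤ B*M1^2 := by positivity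
    nlinarith
  have : 0 ≤ B*M1^2 := by positivity
  constructor <;> linarith

lemma mono_of {f f' : ℝ → ℝ} {s t : ℝ} (hc : ContinuousOn f (Icc s t))
    (hd : ∀ r ∈ Ioo s t, HasDerivAt f (f' r) r) (h0 : ∀ r ∈ Ioo s t, 0 ≤ f' r) :
    MonotoneOn f (Icc s t) := by
  refine monotoneOn_of_hasDerivWithinAt_nonneg (f' := f') (convex_Icc _ _) hc ?_ ?_
  · intro r hr
    rw [interior_Icc] at hr
    exact (hd r hr).hasDerivWithinAt
  · intro r hr
    rw [interior_Icc] at hr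
    exact h0 r hr

lemma anti_of {f f' : ℝ → ℝ} {s t : ℝ} (hc : ContinuousOn f (Icc s t))
    (hd : ∀ r ∈ Ioo s t, HasDerivAt f (f' r) r) (h0 : ∀ r ∈ Ioo s t, f' r ≤ 0) :
    AntitoneOn f (Icc s t) := by
  refine antitoneOn_of_hasDerivWithinAt_nonpos (f' := f') (convex_Icc _ _) hc ?_ ?_
  · intro r hr
    rw [interior_Icc] at hr
    exact (hd r hr).hasDerivWithinAt
  · intro r hr
    rw [interior_Icc] at hr
    exact h0 r hr

/-- Quantitative estimates on the last nodal interval. -/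
lemma last_pos {k : ℕ} {p ρ : ℝ} {u u1 : ℝ → ℝ} (h : Rad k p u u1) (hp : 1 < p)
    (hρ : 0 < ρ) (hρ1 : ρ < 1) (hu : ∀ r ∈ Ioo ρ 1, 0 < u r) (huρ : u ρ = 0) (hU : 0 < u 1)
    (hu1 : u1 1 = 0) :
    (((k:ℝ)+3) * ((k:ℝ)+1) ≤ u 1^(p-1) * (ρ^(k+1))⁻¹) ∧
    0 ≤ u1 ρ ∧ (ρ^(k+2) * u1 ρ ≤ u 1^(p-1) * u 1 / ((k:ℝ)+3)) ∧
    (u 1^(p-1) < 1 →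
      ((1 - √(u 1^(p-1)))^(p+1) * (u 1^(p-1) * u 1) / ((k:ℝ)+3) ≤ ρ^(k+2) * u1 ρ) ∧
      ((1 - √(u 1^(p-1)))^(p+1) * (u 1^(p-1) * (ρ^(k+1))⁻¹) ≤
        ((k:ℝ)+3) * ((k:ℝ)+1) + √(u 1^(p-1)))) := by
  set U := u 1 with hUdef
  set w := U^(p-1) with hw
  set n : ℝ := (k:ℝ)+3 with hn
  set L : ℝ := (k:ℝ)+1 with hL
  have hn0 : 0 < n := by positivity
  have hL0 : 0 < L := by positivity
  have hnL : 1 ≤ n * L := by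
    have : (0:ℝ) ≤ k := Nat.cast_nonneg k
    rw [hn, hL]; nlinarith
  have hw0 : 0 < w := Real.rpow_pos_of_pos hU _
  set g : ℝ → ℝ := fun r => r^(k+2) * u1 r with hg
  have hsub : Icc ρ 1 ⊆ Icc (0:ℝ) 1 := Icc_subset_Icc hρ.le le_rfl
  have hcg : ContinuousOn g (Icc ρ 1) := (continuousOn_pow _).mul (h.cu1.mono hsub)
  have hcu : ContinuousOn u (Icc ρ 1) := h.cu.mono hsub
  have hdg : ∀ r ∈ Ioo ρ 1, HasDerivAt g (-(r^(k+2) * (|u r|^(p-1) * u r))) r := by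
    intro r hr
    have hr0 : 0 < r := hρ.trans hr.1
    have := (hasDerivAt_pow (k+2) r).mul (h.d2 r ⟨hr0, hr.2⟩)
    refine this.congr_deriv ?_
    push_cast
    field_simp
    ring
  have hdu : ∀ r ∈ Ioo ρ 1, HasDerivAt u (g r / r^(k+2)) r := by
    intro r hr
    have hr0 : 0 < r := hρ.trans hr.1
    refine (h.d1 r ⟨hr0, hr.2⟩).congr_deriv ?_
    rw [hg]; field_simp
  have hg1 : g 1 = 0 := by simp [hg, hu1]
  have h1mem : (1:ℝ) ∈ Icc ρ 1 := ⟨hρ1.le, le_rfl⟩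
  have hρmem : ρ ∈ Icc ρ 1 := ⟨le_rfl, hρ1.le⟩
  have hganti : AntitoneOn g (Icc ρ 1) := by
    refine anti_of hcg hdg ?_
    intro r hr
    have hr0 : 0 < r := hρ.trans hr.1
    have := hu r hr
    have : 0 ≤ r^(k+2) * (|u r|^(p-1) * u r) := by positivity
    linarith
  have hg0 : ∀ r ∈ Icc ρ 1, 0 ≤ g r := by
    intro r hr
    have := hganti hr h1mem hr.2
    linarith
  have humono : MonotoneOn u (Icc ρ 1) := by
    refine mono_of hcu hdu ?_
    intro r hr
    have hr0 : 0 < r := hρ.trans hr.1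
    exact div_nonneg (hg0 r (Ioo_subset_Icc_self hr)) (by positivity)
  have hule : ∀ r ∈ Ioo ρ 1, |u r|^(p-1) * u r ≤ w * U := by
    intro r hr
    have h0 := hu r hr
    have h1 := humono (Ioo_subset_Icc_self hr) h1mem hr.2.le
    rw [abs_of_pos h0]
    exact mul_le_mul (Real.rpow_le_rpow h0.le h1 (by linarith)) h1 h0.le hw0.le
  have hdpow : ∀ (C r : ℝ), HasDerivAt (fun r => C * r^(k+3) / n) (C * r^(k+2)) r := by
    intro C r
    have := ((hasDerivAt_pow (k+3) r).const_mul C).div_const n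
    refine this.congr_deriv ?_
    push_cast
    rw [← hn]
    field_simp
  have hdinv : ∀ (C r : ℝ), 0 < r → HasDerivAt (fun r => C / L * (r^(k+1))⁻¹) (-(C / r^(k+2))) r := by
    intro C r hr
    have := ((hasDerivAt_pow (k+1) r).inv (by positivity)).const_mul (C/L)
    refine this.congr_deriv ?_
    push_cast
    rw [← hL]
    field_simp
    ring
  have hcinv : ∀ (C : ℝ) {s t : ℝ}, 0 < s → ContinuousOn (fun r => C / L * (r^(k+1))⁻¹) (Icc s t) := by
    intro C s t hs r hr
    exact (hdinv C r (hs.trans_le hr.1)).continuousAt.continuousWithinAt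
  have hcpow : ∀ (C : ℝ) {s t : ℝ}, ContinuousOn (fun r => C * r^(k+3) / n) (Icc s t) := by
    intro C s t r hr
    exact (hdpow C r).continuousAt.continuousWithinAt
  -- upper bound on the flux
  have hgle : ∀ r ∈ Icc ρ 1, g r ≤ w * U / n := by
    have hm : MonotoneOn (fun r => g r + w * U * r^(k+3) / n) (Icc ρ 1) := by
      refine mono_of (hcg.add (hcpow _)) (fun r hr => (hdg r hr).add (hdpow _ r)) ?_
      intro r hr
      have hr0 : 0 < r := hρ.trans hr.1
      have := mul_le_mul_of_nonneg_left (hule r hr) (by positivity : 0 ≤ r^(k+2))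
      linarith
    intro r hr
    have hr0 : 0 < r := hρ.trans_le hr.1
    have := hm hr h1mem hr.2
    simp only [hg1, one_pow, mul_one, zero_add] at this
    have h3 : 0 ≤ w * U * r^(k+3)/n := by positivity
    linarith
  have huinv : AntitoneOn (fun r => u r + w * U / n / L * (r^(k+1))⁻¹) (Icc ρ 1) := by
    refine anti_of (hcu.add (hcinv _ hρ)) (fun r hr => (hdu r hr).add (hdinv _ r (hρ.trans hr.1))) ?_
    intro r hr
    have hr0 : 0 < r := hρ.trans hr.1
    have := div_le_div_of_nonneg_right (hgle r (Ioo_subset_Icc_self hr)) (by positivity : 0 ≤ r^(k+2))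
    linarith
  have hC0 : 0 < w * U / n / L := by positivity
  have hulow : ∀ r ∈ Icc ρ 1, U - w * U / n / L * (r^(k+1))⁻¹ ≤ u r := by
    intro r hr
    have := huinv hr h1mem hr.2
    simp only [one_pow, inv_one, mul_one] at this
    linarith
  have hi : n * L ≤ w * (ρ^(k+1))⁻¹ := by
    have := hulow ρ hρmem
    rw [huρ] at this
    have e : w * U / n / L * (ρ^(k+1))⁻¹ = U * (w * (ρ^(k+1))⁻¹ / (n*L)) := by field_simp
    rw [e] at this
    have h2 : 1 ≤ w * (ρ^(k+1))⁻¹ / (n*L) := by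
      refine le_of_mul_le_mul_left (a := U) ?_ hU
      linarith
    rwa [one_le_div (by positivity)] at h2
  refine ⟨hi, ?_, hgle ρ hρmem, ?_⟩
  · have := hg0 ρ hρmem
    exact nonneg_of_mul_nonneg_right this (by positivity)
  intro hw1
  set q := √w with hq
  have hq0 : 0 < q := Real.sqrt_pos.2 hw0
  have hqq : q * q = w := Real.mul_self_sqrt hw0.le
  have hq1 : q < 1 := by nlinarith
  set s := q^(1/L) with hs
  have hs0 : 0 < s := Real.rpow_pos_of_pos hq0 _
  have hsL : s^(k+1) = q := by
    rw [hs, ← Real.rpow_natCast, ← Real.rpow_mul hq0.le]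
    push_cast
    rw [← hL, one_div_mul_cancel hL0.ne', Real.rpow_one]
  have hs1 : s < 1 := Real.rpow_lt_one hq0.le hq1 (by positivity)
  have hρs : ρ ≤ s := by
    by_contra hcon
    push Not at hcon
    have h1 : s^(k+1) < ρ^(k+1) := pow_lt_pow_left₀ hcon hs0.le (by simp)
    have h2 : n * L * ρ^(k+1) ≤ w := by
      rwa [← div_eq_mul_inv, le_div_iff₀ (by positivity)] at hi
    have h3 : 1 * ρ^(k+1) ≤ n*L*ρ^(k+1) := mul_le_mul_of_nonneg_right hnL (by positivity)
    rw [hsL] at h1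
    nlinarith
  have hsmem : s ∈ Icc ρ 1 := ⟨hρs, hs1.le⟩
  have hus : (1-q) * U ≤ u s := by
    have := hulow s hsmem
    have e : w * U / n / L * (s^(k+1))⁻¹ = q * U / (n * L) := by
      rw [hsL, ← hqq]; field_simp
    have e2 : q * U / (n*L) ≤ q * U := div_le_self (by positivity) hnL
    linarith
  set T := (1-q)^p with hT
  have h1q : 0 < 1 - q := by linarith
  have hT0 : 0 < T := Real.rpow_pos_of_pos h1q _
  have hTT : (1-q)^(p+1) = T * (1-q) := Real.rpow_add_one h1q.ne' p
  have hTle : (1-q)^(p+1) ≤ 1 := Real.rpow_le_one h1q.le (by linarith) (by linarith)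
  have hugt : ∀ r ∈ Ioo s 1, T * (w * U) ≤ |u r|^(p-1) * u r := by
    intro r hr
    have hrm : r ∈ Ioo ρ 1 := ⟨hρs.trans_lt hr.1, hr.2⟩
    have h1 := humono hsmem (Ioo_subset_Icc_self hrm) hr.1.le
    rw [abs_of_pos (hu r hrm)]
    have e : T * (w * U) = ((1-q)*U)^(p-1) * ((1-q)*U) := by
      rw [Real.mul_rpow h1q.le hU.le, hT, hw]
      conv_lhs => rw [show p = (p-1)+1 by ring, Real.rpow_add_one h1q.ne']
      ring_nf
    rw [e]
    have h2 : (1-q)*U ≤ u r := hus.trans h1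
    have h3 : 0 ≤ (1-q)*U := by positivity
    exact mul_le_mul (Real.rpow_le_rpow h3 h2 (by linarith)) h2 h3 (Real.rpow_nonneg (hu r hrm).le _)
  set G := (1-q)^(p+1) * (w*U) / n with hG
  have hG0 : 0 < G := by positivity
  have hgs : G ≤ g s := by
    have ha : AntitoneOn (fun r => g r + T * (w * U) * r^(k+3) / n) (Icc s 1) := by
      refine anti_of ((hcg.mono (Icc_subset_Icc hρs le_rfl)).add (hcpow _))
        (fun r hr => (hdg r ⟨hρs.trans_lt hr.1, hr.2⟩).add (hdpow _ r)) ?_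
      intro r hr
      have hr0 : 0 < r := hs0.trans hr.1
      have := mul_le_mul_of_nonneg_left (hugt r hr) (by positivity : 0 ≤ r^(k+2))
      linarith
    have := ha (left_mem_Icc.2 hs1.le) (right_mem_Icc.2 hs1.le) hs1.le
    simp only [hg1, one_pow, mul_one, zero_add] at this
    have h3 : s^(k+3) ≤ q := by
      rw [← hsL]
      exact pow_le_pow_of_le_one hs0.le hs1.le (by omega)
    have h4 : T * (w * U) * s^(k+3) / n ≤ T * (w * U) * q / n := by gcongr
    have h5 : G = T * (w*U)/n - T * (w * U) * q / n := by rw [hG, hTT]; ring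
    linarith
  refine ⟨hgs.trans (hganti hρmem hsmem hρs), ?_⟩
  have hm : MonotoneOn (fun r => u r + G / L * (r^(k+1))⁻¹) (Icc ρ s) := by
    refine mono_of ((hcu.mono (Icc_subset_Icc le_rfl hs1.le)).add (hcinv _ hρ))
      (fun r hr => (hdu r ⟨hr.1, hr.2.trans hs1⟩).add (hdinv _ r (hρ.trans hr.1))) ?_
    intro r hr
    have hr0 : 0 < r := hρ.trans hr.1
    have h1 := hganti ⟨hr.1.le, hr.2.le.trans hs1.le⟩ hsmem hr.2.le
    have := div_le_div_of_nonneg_right (hgs.trans h1) (by positivity : 0 ≤ r^(k+2))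
    linarith
  have h6 := hm (left_mem_Icc.2 hρs) (right_mem_Icc.2 hρs) hρs
  simp only [huρ, zero_add, hsL] at h6
  have h7 := humono hsmem h1mem hs1.le
  have h8 : G / L * (ρ^(k+1))⁻¹ ≤ U + G/L * q⁻¹ := by linarith
  have e1 : G / L * (ρ^(k+1))⁻¹ = U/(n*L) * ((1-q)^(p+1) * (w * (ρ^(k+1))⁻¹)) := by
    rw [hG]; field_simp
  have e2 : U + G/L * q⁻¹ = U/(n*L) * (n*L + (1-q)^(p+1) * q) := by
    rw [hG, ← hqq]; field_simp
  rw [e1, e2] at h8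
  have h9 := le_of_mul_le_mul_left h8 (by positivity)
  have h10 : (1-q)^(p+1) * q ≤ 1 * q := mul_le_mul_of_nonneg_right hTle hq0.le
  linarith

lemma nodal_energy {p b c M : ℝ} {y z u : ℝ → ℝ} {m : ℕ} {ρ : ℕ → ℝ} (hm : 2 ≤ m)
    (h : EF_s15 p b c 0 1 y z) (hp : 1 < p) (hb : 0 < b)
    (hc : 0 ≤ c) (h0 : En p b (y 0) (z 0) = 0)
    (hyu : ∀ r ∈ Ioo (0:ℝ) 1, u r ≠ 0 → y r ≠ 0)
    (hM : ∀ Y Z, En p b Y Z ≤ 1 → |Y| ≤ M ∧ |Z| ≤ M)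
    (hlt : (m:ℝ) * (4 * c * M^2) < 1)
    (hρ : ∀ j, 1 ≤ j → j ≤ m - 1 → ρ j ∈ Ioo (0:ℝ) 1)
    (hdec : ∀ j, 1 ≤ j → j + 1 ≤ m - 1 → ρ (j+1) < ρ j)
    (hz : ∀ r ∈ Ioo (0:ℝ) 1, u r = 0 → ∃ j, 1 ≤ j ∧ j ≤ m - 1 ∧ ρ j = r) :
    En p b (y 1) (z 1) ≤ m * (4 * c * M^2) := by
  set D := 4 * c * M^2 with hD
  have hD0 : 0 ≤ D := by positivity
  have hanti : ∀ i j, 1 ≤ i → i ≤ j → j ≤ m - 1 → ρ j ≤ ρ i := by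
    intro i j hi hij
    induction j, hij using Nat.le_induction with
    | base => intro _; exact le_rfl
    | succ j hj ih =>
      intro hjm
      exact (hdec j (hi.trans hj) hjm).le.trans (ih (by omega))
  have step : ∀ (α β : ℝ) (j : ℕ), 0 ≤ α → α < β → β ≤ 1 → j + 1 ≤ m →
      (∀ i, 1 ≤ i → i ≤ m - 1 → ρ i ≤ α ∨ β ≤ ρ i) →
      (0 ≤ En p b (y α) (z α) ∧ En p b (y α) (z α) ≤ j * D) →
      (0 ≤ En p b (y β) (z β) ∧ En p b (y β) (z β) ≤ ((j+1 : ℕ):ℝ) * D) := by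
    intro α β j hα hαβ hβ hj hno hE
    have hjm : ((j+1 : ℕ):ℝ) * D ≤ m * D := mul_le_mul_of_nonneg_right (by exact_mod_cast hj) hD0
    push_cast at hjm ⊢
    have := (h.mono hα hβ).hump hp hb hc hα hαβ ?_ hE.1 hM (by rw [← hD]; linarith [hE.2])
    · exact ⟨this.1, by linarith [this.2, hE.2]⟩
    · intro r hr
      have hr01 : r ∈ Ioo (0:ℝ) 1 := ⟨hα.trans_lt hr.1, hr.2.trans_le hβ⟩
      refine hyu r hr01 (fun hcon => ?_)
      obtain ⟨i, hi1, hi2, rfl⟩ := hz r hr01 hcon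
      rcases hno i hi1 hi2 with h | h
      · exact absurd hr.1 (not_lt.2 h)
      · exact absurd hr.2 (not_lt.2 h)
  have ind : ∀ j, 1 ≤ j → j ≤ m - 1 → 0 ≤ En p b (y (ρ (m-j))) (z (ρ (m-j))) ∧
      En p b (y (ρ (m-j))) (z (ρ (m-j))) ≤ j * D := by
    intro j hj
    induction j, hj using Nat.le_induction with
    | base =>
      intro _
      have hr := hρ (m-1) (by omega) le_rfl
      exact step 0 (ρ (m-1)) 0 le_rfl hr.1 hr.2.le (by omega)
        (fun i hi1 hi2 => Or.inr (hanti i (m-1) hi1 hi2 le_rfl)) (by simp [h0])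
    | succ j hj ih =>
      intro hjm
      have ih := ih (by omega)
      have e : m - j = (m - (j+1)) + 1 := by omega
      have hr := hρ (m-j) (by omega) (by omega)
      have hr' := hρ (m-(j+1)) (by omega) (by omega)
      refine step (ρ (m-j)) (ρ (m-(j+1))) j hr.1.le ?_ hr'.2.le (by omega) ?_ ih
      · rw [e]; exact hdec _ (by omega) (by omega)
      · intro i hi1 hi2
        rcases le_or_gt i (m-(j+1)) with hle | hgt
        · exact Or.inr (hanti i _ hi1 hle (by omega))
        · exact Or.inl (hanti (m-j) i (by omega) (by omega) hi2)
  have i1 := ind (m-1) (by omega) le_rfl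
  rw [show m - (m-1) = 1 by omega] at i1
  have hr := hρ 1 le_rfl (by omega)
  have := (step (ρ 1) 1 (m-1) hr.1.le hr.2 le_rfl (by omega)
    (fun i hi1 hi2 => Or.inl (hanti 1 i le_rfl hi1 hi2)) i1).2
  rwa [show m - 1 + 1 = m by omega] at this

lemma last_abs {k : ℕ} {p ρ : ℝ} {u u1 : ℝ → ℝ} (h : Rad k p u u1) (hp : 1 < p)
    (hρ : 0 < ρ) (hρ1 : ρ < 1) (hu : ∀ r ∈ Ioc ρ 1, u r ≠ 0) (huρ : u ρ = 0)
    (hu1 : u1 1 = 0) :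
    (((k:ℝ)+3) * ((k:ℝ)+1) ≤ |u 1|^(p-1) * (ρ^(k+1))⁻¹) ∧
    (ρ^(k+2) * |u1 ρ| ≤ |u 1|^(p-1) * |u 1| / ((k:ℝ)+3)) ∧
    (|u 1|^(p-1) < 1 →
      ((1 - √(|u 1|^(p-1)))^(p+1) * (|u 1|^(p-1) * |u 1|) / ((k:ℝ)+3) ≤ ρ^(k+2) * |u1 ρ|) ∧
      ((1 - √(|u 1|^(p-1)))^(p+1) * (|u 1|^(p-1) * (ρ^(k+1))⁻¹) ≤
        ((k:ℝ)+3) * ((k:ℝ)+1) + √(|u 1|^(p-1)))) := by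
  have hc : ContinuousOn u (Ioc ρ 1) := h.cu.mono (fun r hr => ⟨(hρ.trans hr.1).le, hr.2⟩)
  have h1m : (1:ℝ) ∈ Ioc ρ 1 := ⟨hρ1, le_rfl⟩
  have hoc := (isPreconnected_Ioc.image u hc).ordConnected
  rcases lt_or_gt_of_ne (hu 1 h1m) with hneg | hpos
  · have := last_pos h.neg hp hρ hρ1 (fun r hr => ?_) (by simp [huρ]) (by simpa using hneg) (by simp [hu1])
    · rw [abs_of_neg hneg]
      have h2 : |u1 ρ| = - u1 ρ := by
        rw [abs_of_nonpos]; linarith [this.2.1]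
      rw [h2]
      exact ⟨this.1, this.2.2⟩
    · have hr' : r ∈ Ioc ρ 1 := ⟨hr.1, hr.2.le⟩
      by_contra hcon
      have hcon : 0 ≤ u r := by simpa using hcon
      obtain ⟨x, hx, hx0⟩ := hoc.out (mem_image_of_mem u h1m) (mem_image_of_mem u hr')
        (show (0:ℝ) ∈ Icc _ _ from ⟨hneg.le, hcon⟩)
      exact hu x hx hx0
  · have := last_pos h hp hρ hρ1 (fun r hr => ?_) huρ hpos hu1
    · rw [abs_of_pos hpos, abs_of_nonneg this.2.1]
      exact ⟨this.1, this.2.2⟩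
    · have hr' : r ∈ Ioc ρ 1 := ⟨hr.1, hr.2.le⟩
      by_contra hcon
      push Not at hcon
      obtain ⟨x, hx, hx0⟩ := hoc.out (mem_image_of_mem u hr') (mem_image_of_mem u h1m)
        (show (0:ℝ) ∈ Icc _ _ from ⟨hcon, hpos.le⟩)
      exact hu x hx hx0

/-- Everything we need about a single Neumann solution. -/
lemma per_eps {k m : ℕ} {p M : ℝ} {u : ℝ → ℝ} {ρ δ : ℕ → ℝ} (hm : 2 ≤ m)
    (h : NeumannData (k+3) p m u ρ δ) (hp3 : 3/((k:ℝ)+1) ≤ p - 1) (hp4 : p - 1 ≤ 4/((k:ℝ)+1))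
    (hM : ∀ b, b ≤ (((k:ℝ)+1)/2)^2 → ∀ Y Z, En p b Y Z ≤ 1 → |Y| ≤ M ∧ |Z| ≤ M)
    (hlt : (m:ℝ) * (4 * (2*(2/(p-1))-((k:ℝ)+1)) * M^2) < 1) :
    0 < ρ 1 ∧ u 1 ≠ 0 ∧
    |u 1|^(p+1)/(p+1) ≤ (m:ℝ) * (4 * (2*(2/(p-1))-((k:ℝ)+1)) * M^2) ∧
    (((k:ℝ)+3) * ((k:ℝ)+1) ≤ |u 1|^(p-1) * (ρ 1^(k+1))⁻¹) ∧
    (ρ 1^(k+2) * |deriv u (ρ 1)| ≤ |u 1|^(p-1) * |u 1| / ((k:ℝ)+3)) ∧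
    (|u 1|^(p-1) < 1 →
      ((1 - √(|u 1|^(p-1)))^(p+1) * (|u 1|^(p-1) * |u 1|) / ((k:ℝ)+3) ≤ ρ 1^(k+2) * |deriv u (ρ 1)|) ∧
      ((1 - √(|u 1|^(p-1)))^(p+1) * (|u 1|^(p-1) * (ρ 1^(k+1))⁻¹) ≤
        ((k:ℝ)+3) * ((k:ℝ)+1) + √(|u 1|^(p-1)))) := by
  obtain ⟨hsol, hd1, hδ1, hδm, hρδ, hδρ, hzero, hcrit⟩ := h
  have hL : (0:ℝ) < (k:ℝ)+1 := by positivity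
  have hp0 : 0 < p - 1 := lt_of_lt_of_le (by positivity) hp3
  have hp : 1 < p := by linarith
  have hR := rad_of hsol
  have hρm : ∀ j, 1 ≤ j → j ≤ m - 1 → ρ j ∈ Ioo (0:ℝ) 1 ∧ u (ρ j) = 0 := by
    intro j h1 h2
    have : ρ j ∈ {r : ℝ | r ∈ Set.Ioo (0 : ℝ) 1 ∧ u r = 0} := by
      rw [hzero]; exact mem_image_of_mem ρ ⟨h1, h2⟩
    exact this
  have hz : ∀ r ∈ Ioo (0:ℝ) 1, u r = 0 → ∃ j, 1 ≤ j ∧ j ≤ m - 1 ∧ ρ j = r := by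
    intro r hr h0
    have : r ∈ {r : ℝ | r ∈ Set.Ioo (0 : ℝ) 1 ∧ u r = 0} := ⟨hr, h0⟩
    rw [hzero] at this
    obtain ⟨j, hj, hj'⟩ := this
    exact ⟨j, hj.1, hj.2, hj'⟩
  have hdec : ∀ j, 1 ≤ j → j + 1 ≤ m - 1 → ρ (j+1) < ρ j := fun j h1 h2 =>
    (hρδ (j+1) (by omega) h2).trans (hδρ j h1 (by omega))
  have hanti : ∀ j, 1 ≤ j → j ≤ m - 1 → ρ j ≤ ρ 1 := by
    intro j hj
    induction j, hj using Nat.le_induction with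
    | base => intro _; exact le_rfl
    | succ j hj ih =>
      intro hjm
      exact (hdec j hj hjm).le.trans (ih (by omega))
  obtain ⟨⟨hρ0, hρ1⟩, huρ⟩ := hρm 1 le_rfl (by omega)
  have hne : ∀ r ∈ Ioo (ρ 1) 1, u r ≠ 0 := by
    intro r hr h0
    obtain ⟨j, h1, h2, rfl⟩ := hz r ⟨hρ0.trans hr.1, hr.2⟩ h0
    exact absurd hr.1 (not_lt.2 (hanti j h1 h2))
  have hU : u 1 ≠ 0 := by
    intro hU
    obtain ⟨x, hx, hx0⟩ := exists_deriv_eq_zero hρ1 (hR.cu.mono (Icc_subset_Icc hρ0.le le_rfl))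
      (huρ.trans hU.symm)
    have : x ∈ {r : ℝ | r ∈ Set.Icc (0 : ℝ) 1 ∧ deriv u r = 0} :=
      ⟨⟨(hρ0.trans hx.1).le, hx.2.le⟩, hx0⟩
    rw [hcrit] at this
    obtain ⟨j, ⟨hj1, hj2⟩, rfl⟩ := this
    rcases Nat.eq_or_lt_of_le hj1 with rfl | hj
    · exact absurd hx.2 (by rw [hδ1]; exact lt_irrefl _)
    · obtain ⟨i, rfl⟩ : ∃ i, j = i + 1 := ⟨j-1, by omega⟩
      have h1 := hδρ i (by omega) (by omega)
      have h2 := hanti i (by omega) (by omega)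
      linarith [hx.1]
  have hu1 := rad_neumann hsol hd1 hU
  have hder : deriv u (ρ 1) = derivWithin u (Icc 0 1) (ρ 1) := (hR.d1 _ ⟨hρ0, hρ1⟩).deriv
  have hlast := last_abs hR hp hρ0 hρ1 (fun r hr => by
    rcases eq_or_lt_of_le hr.2 with rfl | h
    · exact hU
    · exact hne r ⟨hr.1, h⟩) huρ hu1
  rw [← hder] at hlast
  refine ⟨hρ0, hU, ?_, hlast⟩
  set a := 2/(p-1) with ha
  have ha0 : 0 < a := by positivity
  have hEF := ef_of_rad hR hp ha
  have hap : a * (p-1) = 2 := by rw [ha]; field_simp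
  rw [div_le_iff₀ hL] at hp3
  rw [le_div_iff₀ hL] at hp4
  have ha1 : a < (k:ℝ)+1 := by
    by_contra hcon
    push Not at hcon
    nlinarith
  have hc : 0 ≤ 2*a - ((k:ℝ)+1) := by
    by_contra hcon
    push Not at hcon
    nlinarith
  have hb : 0 < a*((k:ℝ)+1-a) := mul_pos ha0 (by linarith)
  have hbB : a*((k:ℝ)+1-a) ≤ (((k:ℝ)+1)/2)^2 := by nlinarith [sq_nonneg (a - ((k:ℝ)+1)/2)]
  have hEn := nodal_energy (u := u) (ρ := ρ) hm hEF hp hb hc (by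
      simp [En, Real.zero_rpow ha0.ne', Real.zero_rpow (by linarith : p + 1 ≠ 0)])
    (fun r hr hur => mul_ne_zero (Real.rpow_pos_of_pos hr.1 a).ne' hur)
    (hM _ hbB) hlt (fun j h1 h2 => (hρm j h1 h2).1) hdec hz
  refine le_trans ?_ hEn
  simp only [En, Real.one_rpow, one_mul, hu1]
  have : 0 ≤ a * (2*a - ((k:ℝ)+1)) * u 1^2 := by positivity
  nlinarith

/-- **Lemma 3.6.** For radial Neumann solutions with `m-1` interior zeros (largest
interior zero `ρ_{1,ε}`, largest critical point `δ_{1,ε} = 1`):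
`|u_ε(1)|^{4/(n-2)-ε} ρ_{1,ε}^{2-n} → n(n-2)` and
`|u_ε'(ρ_{1,ε})| ρ_{1,ε}^{n-1} |u_ε(1)|^{ε-(n+2)/(n-2)} → 1/n` as `ε → 0⁺`. -/
theorem neumann_two_equations (n m : ℕ) (hn : 3 ≤ n) (hm : 2 ≤ m)
    (u : ℝ → ℝ → ℝ) (ρ δ : ℝ → ℕ → ℝ)
    (hu : ∀ ε ∈ Set.Ioo (0 : ℝ) (4 / ((n : ℝ) - 2)),
      NeumannData n (pEps n ε) m (u ε) (ρ ε) (δ ε)) :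
    Tendsto (fun ε : ℝ => |u ε 1| ^ ((4 : ℝ) / ((n : ℝ) - 2) - ε) *
        ρ ε 1 ^ ((2 : ℝ) - (n : ℝ)))
      (𝓝[>] (0 : ℝ)) (𝓝 ((n : ℝ) * ((n : ℝ) - 2))) ∧
    Tendsto (fun ε : ℝ => |deriv (u ε) (ρ ε 1)| * ρ ε 1 ^ (n - 1) *
        |u ε 1| ^ (ε - ((n : ℝ) + 2) / ((n : ℝ) - 2)))
      (𝓝[>] (0 : ℝ)) (𝓝 (1 / (n : ℝ))) := by
  obtain ⟨k, rfl⟩ : ∃ k, n = k + 3 := ⟨n-3, by omega⟩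
  have hL : (0:ℝ) < (k:ℝ)+1 := by positivity
  have e1 : ((k+3 : ℕ):ℝ) - 2 = (k:ℝ)+1 := by push_cast; ring
  have e2 : ((k+3 : ℕ):ℝ) + 2 = (k:ℝ)+5 := by push_cast; ring
  have e3 : (2:ℝ) - ((k+3 : ℕ):ℝ) = -((k+1 : ℕ):ℝ) := by push_cast; ring
  have e4 : ((k+3 : ℕ):ℝ) = (k:ℝ)+3 := by push_cast; ring
  rw [e3]
  simp only [pEps] at hu
  simp only [e1, e2] at *
  rw [e4]
  set P : ℝ := ((k:ℝ)+5)/((k:ℝ)+1) with hP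
  have hP0 : 0 < P := by positivity
  have hP1 : P = 1 + 4/((k:ℝ)+1) := by rw [hP]; field_simp; ring
  obtain ⟨M, hM⟩ := En_bound ((((k:ℝ)+1)/2)^2) (3/((k:ℝ)+1)) P (by positivity) (by positivity) hP0.le
  set c : ℝ → ℝ := fun ε => 2*(2/(P - ε - 1)) - ((k:ℝ)+1) with hc
  have tid : Tendsto (fun ε : ℝ => ε) (𝓝[>] 0) (𝓝 0) := tendsto_nhdsWithin_of_tendsto_nhds tendsto_id
  have tp : Tendsto (fun ε : ℝ => P - ε) (𝓝[>] 0) (𝓝 P) := by simpa using tid.const_sub P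
  have tc : Tendsto c (𝓝[>] 0) (𝓝 0) := by
    have hne : P - 1 ≠ 0 := by rw [hP1]; simp; positivity
    have := (((tendsto_const_nhds (x := (2:ℝ))).div (tp.sub_const 1) hne).const_mul 2).sub_const ((k:ℝ)+1)
    have e : 2 * (2/(P-1)) - ((k:ℝ)+1) = 0 := by rw [hP1]; field_simp; ring
    rw [e] at this
    exact this
  have tD : Tendsto (fun ε => (m:ℝ) * (4 * c ε * M^2)) (𝓝[>] 0) (𝓝 0) := by
    have := (((tc.const_mul 4).mul_const (M^2)).const_mul (m:ℝ))
    simpa using this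
  have hev : ∀ᶠ ε in 𝓝[>] (0:ℝ), 0 < ε ∧ ε < 1/((k:ℝ)+1) := by
    filter_upwards [Ioo_mem_nhdsGT (show (0:ℝ) < 1/((k:ℝ)+1) by positivity)] with ε hε
    exact hε
  have hall : ∀ᶠ ε in 𝓝[>] (0:ℝ), 0 < ε ∧ ε < 1/((k:ℝ)+1) ∧ 0 < ρ ε 1 ∧ u ε 1 ≠ 0 ∧
    |u ε 1|^((P-ε)+1)/((P-ε)+1) ≤ (m:ℝ) * (4 * c ε * M^2) ∧
    (((k:ℝ)+3) * ((k:ℝ)+1) ≤ |u ε 1|^((P-ε)-1) * (ρ ε 1^(k+1))⁻¹) ∧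
    (ρ ε 1^(k+2) * |deriv (u ε) (ρ ε 1)| ≤ |u ε 1|^((P-ε)-1) * |u ε 1| / ((k:ℝ)+3)) ∧
    (|u ε 1|^((P-ε)-1) < 1 →
      ((1 - √(|u ε 1|^((P-ε)-1)))^((P-ε)+1) * (|u ε 1|^((P-ε)-1) * |u ε 1|) / ((k:ℝ)+3) ≤ ρ ε 1^(k+2) * |deriv (u ε) (ρ ε 1)|) ∧
      ((1 - √(|u ε 1|^((P-ε)-1)))^((P-ε)+1) * (|u ε 1|^((P-ε)-1) * (ρ ε 1^(k+1))⁻¹) ≤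
        ((k:ℝ)+3) * ((k:ℝ)+1) + √(|u ε 1|^((P-ε)-1)))) := by
    filter_upwards [hev, tD.eventually (gt_mem_nhds one_pos)] with ε hε hlt
    have h34 : 1/((k:ℝ)+1) + 3/((k:ℝ)+1) = 4/((k:ℝ)+1) := by ring
    have h3pos : 0 < 3/((k:ℝ)+1) := by positivity
    have hq : 3/((k:ℝ)+1) ≤ (P - ε) - 1 := by rw [hP1]; linarith [hε.2]
    exact ⟨hε.1, hε.2, per_eps hm (hu ε ⟨hε.1, by linarith [hε.2]⟩) hq (by rw [hP1]; linarith [hε.1])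
      (fun b hb => hM _ b hq (by linarith [hε.1]) hb) hlt⟩
  set W : ℝ → ℝ := fun ε => |u ε 1|^((P-ε)-1) with hW
  have tU : Tendsto (fun ε => |u ε 1|^((P-ε)+1)) (𝓝[>] 0) (𝓝 0) := by
    have t1 : Tendsto (fun ε => ((P-ε)+1) * ((m:ℝ) * (4 * c ε * M^2))) (𝓝[>] 0) (𝓝 0) := by
      simpa using (tp.add_const 1).mul tD
    refine tendsto_of_tendsto_of_tendsto_of_le_of_le' tendsto_const_nhds t1 ?_ ?_
    · exact Eventually.of_forall (fun ε => Real.rpow_nonneg (abs_nonneg _) _)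
    · filter_upwards [hall, tp.eventually (lt_mem_nhds hP0)] with ε h hp
      have := h.2.2.2.2.1
      rw [div_le_iff₀ (by linarith)] at this
      linarith
  have tW : Tendsto W (𝓝[>] 0) (𝓝 0) := by
    have hpos : 0 < (P-1)/(P+1) := by
      apply div_pos _ (by linarith)
      rw [hP1]; simp; positivity
    have te : Tendsto (fun ε => ((P-ε)-1)/((P-ε)+1)) (𝓝[>] 0) (𝓝 ((P-1)/(P+1))) :=
      (tp.sub_const 1).div (tp.add_const 1) (by positivity)
    have := tU.rpow te (Or.inr hpos)
    rw [Real.zero_rpow hpos.ne'] at this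
    refine this.congr' ?_
    filter_upwards [tp.eventually (lt_mem_nhds hP0)] with ε hp
    rw [← Real.rpow_mul (abs_nonneg _), mul_div_cancel₀ _ (by linarith)]
  have tq : Tendsto (fun ε => √(W ε)) (𝓝[>] 0) (𝓝 0) := by
    have := (Real.continuous_sqrt.tendsto 0).comp tW
    rw [Real.sqrt_zero] at this
    exact this
  have tT : Tendsto (fun ε => (1 - √(W ε))^((P-ε)+1)) (𝓝[>] 0) (𝓝 1) := by
    have := (tq.const_sub 1).rpow (tp.add_const 1) (Or.inl (by norm_num))
    simpa using this
  have hW1 : ∀ᶠ ε in 𝓝[>] (0:ℝ), W ε < 1 := tW.eventually (gt_mem_nhds one_pos)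
  have hT0 : ∀ᶠ ε in 𝓝[>] (0:ℝ), 0 < (1 - √(W ε))^((P-ε)+1) := tT.eventually (lt_mem_nhds one_pos)
  constructor
  · have tup : Tendsto (fun ε => (((k:ℝ)+3) * ((k:ℝ)+1) + √(W ε)) / (1 - √(W ε))^((P-ε)+1)) (𝓝[>] 0)
        (𝓝 (((k:ℝ)+3) * ((k:ℝ)+1))) := by
      have := (tq.const_add (((k:ℝ)+3) * ((k:ℝ)+1))).div tT one_ne_zero
      rw [add_zero, div_one] at this
      exact this
    have hcong : ∀ᶠ ε in 𝓝[>] (0:ℝ), |u ε 1| ^ (4 / ((k:ℝ)+1) - ε) * ρ ε 1 ^ (-((k+1 : ℕ):ℝ))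
        = W ε * (ρ ε 1^(k+1))⁻¹ := by
      filter_upwards [hall] with ε h
      rw [Real.rpow_neg h.2.2.1.le, Real.rpow_natCast, hW, hP1]
      ring_nf
    refine tendsto_of_tendsto_of_tendsto_of_le_of_le' tendsto_const_nhds tup ?_ ?_
    · filter_upwards [hall, hcong] with ε h he
      rw [he]; exact h.2.2.2.2.2.1
    · filter_upwards [hall, hcong, hW1, hT0] with ε h he h1 h0
      rw [he, le_div_iff₀ h0, mul_comm]
      exact (h.2.2.2.2.2.2.2 h1).2
  · have tlow : Tendsto (fun ε => (1 - √(W ε))^((P-ε)+1) / ((k:ℝ)+3)) (𝓝[>] 0) (𝓝 (1/((k:ℝ)+3))) :=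
      tT.div_const _
    have hcong : ∀ᶠ ε in 𝓝[>] (0:ℝ), |deriv (u ε) (ρ ε 1)| * ρ ε 1 ^ (k+3-1) * |u ε 1| ^ (ε - P)
        = (ρ ε 1^(k+2) * |deriv (u ε) (ρ ε 1)|) / (W ε * |u ε 1|) ∧ 0 < W ε * |u ε 1| := by
      filter_upwards [hall] with ε h
      have hU : 0 < |u ε 1| := abs_pos.2 h.2.2.2.1
      have e : W ε * |u ε 1| = |u ε 1|^(P-ε) := by
        rw [hW]; simp only
        rw [← Real.rpow_add_one hU.ne']; ring_nf
      rw [e, show ε - P = -(P - ε) by ring, Real.rpow_neg hU.le, show k+3-1 = k+2 from rfl]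
      exact ⟨by ring, Real.rpow_pos_of_pos hU _⟩
    refine tendsto_of_tendsto_of_tendsto_of_le_of_le' tlow tendsto_const_nhds ?_ ?_
    · filter_upwards [hall, hcong, hW1] with ε h he h1
      rw [he.1, le_div_iff₀ he.2]
      have := (h.2.2.2.2.2.2.2 h1).1
      have e : (1 - √(W ε))^((P-ε)+1) / ((k:ℝ)+3) * (W ε * |u ε 1|) =
        (1 - √(W ε))^((P-ε)+1) * (W ε * |u ε 1|) / ((k:ℝ)+3) := by ring
      rw [e]; exact this
    · filter_upwards [hall, hcong] with ε h he
      rw [he.1, div_le_iff₀ he.2]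
      have := h.2.2.2.2.2.2.1
      have e : 1 / ((k:ℝ)+3) * (W ε * |u ε 1|) = W ε * |u ε 1| / ((k:ℝ)+3) := by ring
      rw [e]; exact this
end
end
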